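/- Assume the Riemann Hypothesis. Let γ₁' denote the smallest positive ordinate of a nontrivial zero of ζ. For every pair γ₁, γ₂ of distinct simple zeros of Hardy's Z-function with γ₁, γ₂ ≥ γ₁', one has ḡ_{γ₁,γ₂} > 4(γ₁−γ₂)²(1/γ₁² + 1/γ₂²). -/

import Mathlib

open Complex

/-- The Riemann–Siegel theta function
`ϑ(t) = (1/(2i)) log (Γ(1/4+it/2)/Γ(1/4−it/2)) − (t/2) log π` (real-valued for real `t`). -/
noncomputable def RStheta (t : ℝ) : ℝ :=
  (1 / (2 * Complex.I) * Complex.log (Complex.Gamma (1 / 4 + Complex.I * t / 2) /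
      Complex.Gamma (1 / 4 - Complex.I * t / 2))).re - t / 2 * Real.log Real.pi

/-- Hardy's Z-function `Z(t) = e^{iϑ(t)} ζ(1/2+it)` (real-valued for real `t`). -/
noncomputable def HardyZ (t : ℝ) : ℝ :=
  (Complex.exp (Complex.I * RStheta t) * riemannZeta (1 / 2 + Complex.I * t)).re

/-- `γ` is a simple zero of Hardy's Z-function. -/
def IsSimpleZeroZ (γ : ℝ) : Prop := HardyZ γ = 0 ∧ deriv HardyZ γ ≠ 0

/-- `F̂(t) = −(Z'''/Z')(t) + (3/4)((Z''/Z')(t))²`. -/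
noncomputable def Fhat (t : ℝ) : ℝ :=
  -(iteratedDeriv 3 HardyZ t / deriv HardyZ t) +
    3 / 4 * (iteratedDeriv 2 HardyZ t / deriv HardyZ t) ^ 2

/-- `ĝ_{γ₁,γ₂} = (1/3)(γ₁−γ₂)²(F̂(γ₁)+F̂(γ₂)) − 2`. -/
noncomputable def ghat (γ₁ γ₂ : ℝ) : ℝ :=
  1 / 3 * (γ₁ - γ₂) ^ 2 * (Fhat γ₁ + Fhat γ₂) - 2

/-- `ḡ_{γ₁,γ₂} = (γ₁−γ₂)² Σ_{γ∉{γ₁,γ₂}} [1/(γ−γ₁)² + 1/(γ−γ₂)²]`, the sum running over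
all zeros `γ` of the Z-function other than `γ₁, γ₂`. -/
noncomputable def gbar (γ₁ γ₂ : ℝ) : ℝ :=
  (γ₁ - γ₂) ^ 2 * ∑' γ : {γ : ℝ // HardyZ γ = 0 ∧ γ ≠ γ₁ ∧ γ ≠ γ₂},
    (1 / ((γ : ℝ) - γ₁) ^ 2 + 1 / ((γ : ℝ) - γ₂) ^ 2)

/-- A Lehmer pair: a pair `γ₋ < γ₊` of consecutive simple (positive) zeros of the
Z-function with `ḡ_{γ₋,γ₊} < 4/5`. -/
def IsLehmerPair (γm γp : ℝ) : Prop :=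
  0 < γm ∧ γm < γp ∧ IsSimpleZeroZ γm ∧ IsSimpleZeroZ γp ∧
    (∀ t : ℝ, γm < t → t < γp → HardyZ t ≠ 0) ∧ gbar γm γp < 4 / 5

/-- `γ₁'`: the smallest positive ordinate of a nontrivial zero of `ζ`. -/
noncomputable def firstZeroOrdinate : ℝ :=
  sInf {y : ℝ | 0 < y ∧ ∃ ρ : ℂ, riemannZeta ρ = 0 ∧ 0 < ρ.re ∧ ρ.re < 1 ∧ ρ.im = y}

/-- The completed zeta function on the critical line, which is real there. -/
noncomputable def xiLine (t : ℝ) : ℝ := (completedRiemannZeta (1 / 2 + I * t)).re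

lemma Gammaℝ_conj (s : ℂ) : Gammaℝ (starRingEnd ℂ s) = starRingEnd ℂ (Gammaℝ s) := by
  have hpi : (Real.pi : ℂ).arg ≠ Real.pi := by
    rw [Complex.arg_ofReal_of_nonneg Real.pi_pos.le]
    exact Real.pi_ne_zero.symm
  have h2 : starRingEnd ℂ (s / 2) = starRingEnd ℂ s / 2 := by simp [map_div₀, Complex.conj_ofNat]
  have h3 : -starRingEnd ℂ s / 2 = starRingEnd ℂ (-s / 2) := by
    simp [map_div₀, Complex.conj_ofNat]
  rw [Gammaℝ_def, Gammaℝ_def, map_mul, ← Complex.Gamma_conj, h2, h3, cpow_conj _ _ hpi]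
  simp

lemma completedRiemannZeta_conj_of_ne_zero {s : ℂ} (hs : s ≠ 0) (h : Gammaℝ s ≠ 0) :
    completedRiemannZeta (starRingEnd ℂ s) = starRingEnd ℂ (completedRiemannZeta s) := by
  have hs' : starRingEnd ℂ s ≠ 0 := by simpa using hs
  have h1 := riemannZeta_def_of_ne_zero hs
  have h2 := riemannZeta_def_of_ne_zero hs'
  have h3 := riemannZeta_conj s
  rw [h1, h2, Gammaℝ_conj, map_div₀] at h3
  have h' : starRingEnd ℂ (Gammaℝ s) ≠ 0 := by simpa using h
  field_simp at h3
  exact h3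

lemma half_add_ne_zero (t : ℝ) : (1 / 2 + I * t : ℂ) ≠ 0 := by
  intro h
  have := congrArg re h
  norm_num at this

lemma half_add_ne_one (t : ℝ) : (1 / 2 + I * t : ℂ) ≠ 1 := by
  intro h
  have := congrArg re h
  norm_num at this

lemma Gammaℝ_half_add_ne_zero (t : ℝ) : Gammaℝ (1 / 2 + I * t) ≠ 0 :=
  Gammaℝ_ne_zero_of_re_pos (by norm_num)

lemma conj_half_add (t : ℝ) : starRingEnd ℂ (1 / 2 + I * t) = 1 - (1 / 2 + I * t) := by
  apply Complex.ext <;> norm_num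

lemma completedRiemannZeta_half_add (t : ℝ) :
    completedRiemannZeta (1 / 2 + I * t) = xiLine t := by
  have h := completedRiemannZeta_conj_of_ne_zero (half_add_ne_zero t) (Gammaℝ_half_add_ne_zero t)
  rw [conj_half_add, completedRiemannZeta_one_sub] at h
  exact (Complex.conj_eq_iff_re.mp h.symm).symm

lemma xiLine_neg (t : ℝ) : xiLine (-t) = xiLine t := by
  have h : (1 / 2 + I * ((-t : ℝ) : ℂ) : ℂ) = 1 - (1 / 2 + I * t) := by push_cast; ring
  rw [xiLine, h, completedRiemannZeta_one_sub, xiLine]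

lemma continuous_xiLine : Continuous xiLine := by
  refine Complex.continuous_re.comp (continuous_iff_continuousAt.mpr fun t => ?_)
  exact (differentiableAt_completedZeta (half_add_ne_zero t)
    (half_add_ne_one t)).continuousAt.comp (f := fun t : ℝ => (1 / 2 + I * t : ℂ))
    (by fun_prop)

lemma riemannZeta_half_add_eq_zero_iff (t : ℝ) :
    riemannZeta (1 / 2 + I * t) = 0 ↔ xiLine t = 0 := by
  rw [riemannZeta_def_of_ne_zero (half_add_ne_zero t), completedRiemannZeta_half_add,
    div_eq_zero_iff, or_iff_left (Gammaℝ_half_add_ne_zero t), Complex.ofReal_eq_zero]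

lemma im_eq_zero_of_sq_eq_ofReal {z : ℂ} {x : ℝ} (hx : 0 ≤ x) (h : z ^ 2 = x) : z.im = 0 := by
  have h1 := congrArg re h
  have h2 := congrArg im h
  simp only [sq, mul_re, mul_im, ofReal_re, ofReal_im] at h1 h2
  have h3 : z.re * z.im = 0 := by linarith
  rcases mul_eq_zero.mp h3 with h4 | h4
  · rw [h4] at h1
    nlinarith [sq_nonneg z.im]
  · exact h4

lemma conj_quarter_add (t : ℝ) :
    starRingEnd ℂ (1 / 4 + I * t / 2) = 1 / 4 - I * t / 2 := by
  simp only [map_add, map_div₀, map_mul, map_one, Complex.conj_ofNat, conj_I, conj_ofReal]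
  ring

lemma exp_RStheta_sq (t : ℝ) :
    Complex.exp (I * RStheta t) ^ 2 = Complex.Gamma (1 / 4 + I * t / 2) /
      Complex.Gamma (1 / 4 - I * t / 2) * (Real.pi : ℂ) ^ (-(I * t)) := by
  have hc := conj_quarter_add t
  have hne : Complex.Gamma (1 / 4 + I * t / 2) ≠ 0 :=
    Complex.Gamma_ne_zero_of_re_pos (by norm_num)
  set w := Complex.Gamma (1 / 4 + I * t / 2) / Complex.Gamma (1 / 4 - I * t / 2) with hw
  have hnorm : ‖w‖ = 1 := by
    rw [hw, ← hc, Complex.Gamma_conj, norm_div, Complex.norm_conj, div_self]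
    simpa using hne
  have hw0 : w ≠ 0 := by
    intro h
    simp [h] at hnorm
  have hlog : Complex.log w = I * (w.arg : ℂ) := by
    rw [Complex.log, hnorm]
    simp [mul_comm]
  have hth : (RStheta t : ℂ) = w.arg / 2 - t / 2 * Complex.log Real.pi := by
    have h1 : (1 / (2 * I) * Complex.log w) = ((w.arg / 2 : ℝ) : ℂ) := by
      rw [hlog]
      push_cast
      field_simp
    rw [RStheta, ← hw, h1, ofReal_re, ← Complex.ofReal_log Real.pi_pos.le]
    push_cast
    ring
  have hpi : (Real.pi : ℂ) ≠ 0 := by exact_mod_cast Real.pi_ne_zero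
  rw [← Complex.exp_nat_mul, hth, Complex.cpow_def_of_ne_zero hpi]
  conv_rhs => rw [← Complex.exp_log hw0, hlog]
  rw [← Complex.exp_add]
  congr 1
  push_cast
  ring

lemma HardyZ_eq_zero_iff (t : ℝ) : HardyZ t = 0 ↔ xiLine t = 0 := by
  rw [← riemannZeta_half_add_eq_zero_iff]
  set z := Complex.exp (I * RStheta t) * riemannZeta (1 / 2 + I * t) with hz
  have hc := conj_quarter_add t
  have hne : Complex.Gamma (1 / 4 + I * t / 2) ≠ 0 :=
    Complex.Gamma_ne_zero_of_re_pos (by norm_num)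
  have hpi : (Real.pi : ℂ) ≠ 0 := by exact_mod_cast Real.pi_ne_zero
  have hsq : z ^ 2 = ((xiLine t ^ 2 * Real.pi ^ (1 / 2 : ℝ) /
      ‖Complex.Gamma (1 / 4 + I * t / 2)‖ ^ 2 : ℝ) : ℂ) := by
    have hG : Gammaℝ (1 / 2 + I * t) =
        (Real.pi : ℂ) ^ (-(1 / 2 + I * t) / 2) * Complex.Gamma (1 / 4 + I * t / 2) := by
      rw [Gammaℝ_def]
      ring_nf
    have hpow : ((Real.pi : ℂ) ^ (-(1 / 2 + I * t) / 2)) ^ 2 * (Real.pi : ℂ) ^ (1 / 2 : ℂ) =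
        (Real.pi : ℂ) ^ (-(I * t)) := by
      rw [← Complex.cpow_nat_mul, ← Complex.cpow_add _ _ hpi]
      congr 1
      push_cast
      ring
    have hne2 : (Real.pi : ℂ) ^ (-(1 / 2 + I * t) / 2) ≠ 0 := by
      simp [Complex.cpow_eq_zero_iff, hpi]
    have hne3 : starRingEnd ℂ (Complex.Gamma (1 / 4 + I * t / 2)) ≠ 0 := by simpa using hne
    rw [hz, mul_pow, exp_RStheta_sq, riemannZeta_def_of_ne_zero (half_add_ne_zero t),
      completedRiemannZeta_half_add, hG, ← hpow, ← hc, Complex.Gamma_conj]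
    push_cast
    rw [← Complex.mul_conj', Complex.ofReal_cpow Real.pi_pos.le]
    push_cast
    field_simp
  have him : z.im = 0 := im_eq_zero_of_sq_eq_ofReal (by positivity) hsq
  have hH : HardyZ t = z.re := rfl
  constructor
  · intro h
    have : z = 0 := Complex.ext (by simpa [hH] using h) (by simpa using him)
    rw [hz] at this
    simpa using this
  · intro h
    rw [hH, hz, h]
    simp

/-- The fractional part, cut off to `(1, ∞)`. -/
noncomputable def fractCut : ℝ → ℂ := (Set.Ioi (1 : ℝ)).indicator fun x => ((Int.fract x : ℝ) : ℂ)

lemma norm_fractCut_le (x : ℝ) : ‖fractCut x‖ ≤ 1 := by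
  unfold fractCut
  by_cases hx : x ∈ Set.Ioi (1 : ℝ)
  · rw [Set.indicator_of_mem hx, Complex.norm_real, Real.norm_of_nonneg (Int.fract_nonneg x)]
    exact (Int.fract_lt_one x).le
  · simp [Set.indicator_of_notMem hx]

lemma measurable_fractCut : Measurable fractCut :=
  (Complex.measurable_ofReal.comp measurable_fract).indicator measurableSet_Ioi

lemma differentiableAt_mellin_fractCut {s : ℂ} (hs : s.re < 0) :
    DifferentiableAt ℂ (mellin fractCut) s := by
  refine mellin_differentiableAt_of_isBigO_rpow (a := 0) (b := s.re - 1) ?_ ?_ hs ?_ (by linarith)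
  · refine MeasureTheory.LocallyIntegrable.locallyIntegrableOn ?_ _
    exact (MeasureTheory.locallyIntegrable_const (1 : ℝ)).mono
      measurable_fractCut.aestronglyMeasurable (by simpa using MeasureTheory.ae_of_all _ norm_fractCut_le)
  · refine Asymptotics.IsBigO.of_bound 1 (Filter.Eventually.of_forall fun x => ?_)
    simpa using norm_fractCut_le x
  · refine Asymptotics.IsBigO.of_bound 1 ?_
    filter_upwards [mem_nhdsWithin_of_mem_nhds (Iio_mem_nhds one_pos)] with x hx
    have : x ∉ Set.Ioi (1 : ℝ) := fun h => lt_asymm (Set.mem_Iio.mp hx) (Set.mem_Ioi.mp h)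
    rw [fractCut, Set.indicator_of_notMem this]
    simp

lemma mellin_fractCut_neg (s : ℂ) :
    mellin fractCut (-s) = ∫ x : ℝ in Set.Ioi 1, ((Int.fract x : ℝ) : ℂ) * (x : ℂ) ^ (-(s + 1)) := by
  have h : ∀ x : ℝ, (x : ℂ) ^ (-s - 1) • fractCut x = (Set.Ioi (1 : ℝ)).indicator
      (fun x : ℝ => ((Int.fract x : ℝ) : ℂ) * (x : ℂ) ^ (-(s + 1))) x := by
    intro x
    by_cases hx : x ∈ Set.Ioi (1 : ℝ)
    · rw [fractCut, Set.indicator_of_mem hx, Set.indicator_of_mem hx, smul_eq_mul, mul_comm]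
      ring_nf
    · rw [fractCut, Set.indicator_of_notMem hx, Set.indicator_of_notMem hx, smul_zero]
  simp_rw [mellin, h]
  rw [MeasureTheory.integral_indicator measurableSet_Ioi, MeasureTheory.Measure.restrict_restrict
    measurableSet_Ioi, Set.inter_eq_left.mpr (Set.Ioi_subset_Ioi zero_le_one)]

lemma norm_mellin_fractCut_neg_le {s : ℂ} (hs : 0 < s.re) :
    ‖mellin fractCut (-s)‖ ≤ 1 / s.re := by
  rw [mellin_fractCut_neg]
  have h1 : ∫ x : ℝ in Set.Ioi 1, x ^ (-(s.re + 1)) = 1 / s.re := by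
    rw [integral_Ioi_rpow_of_lt (by linarith) one_pos, Real.one_rpow]
    rw [show -(s.re + 1) + 1 = -s.re by ring, neg_div_neg_eq]
  rw [← h1]
  refine MeasureTheory.norm_integral_le_of_norm_le
    (integrableOn_Ioi_rpow_of_lt (by linarith) one_pos) ?_
  refine (MeasureTheory.ae_restrict_iff' measurableSet_Ioi).mpr (MeasureTheory.ae_of_all _ fun x hx => ?_)
  have hx0 : (0 : ℝ) < x := one_pos.trans hx
  rw [norm_mul, Complex.norm_cpow_eq_rpow_re_of_pos hx0, Complex.norm_real,
    Real.norm_of_nonneg (Int.fract_nonneg x)]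
  have : (-(s + 1)).re = -(s.re + 1) := by simp
  rw [this]
  exact mul_le_of_le_one_left (Real.rpow_nonneg hx0.le _) (Int.fract_lt_one x).le

lemma riemannZeta_eq_of_one_lt_re {s : ℂ} (hs : 1 < s.re) :
    riemannZeta s = s / (s - 1) - s * mellin fractCut (-s) := by
  have hO : (fun n : ℕ => ∑ k ∈ Finset.Icc 1 n, ((fun _ => 1 : ℕ → ℝ) k)) =O[Filter.atTop]
      fun n => (n : ℝ) ^ (1 : ℝ) := by
    simpa using Asymptotics.isBigO_refl _ _
  have h := LSeries_eq_mul_integral_of_nonneg (fun _ => 1) zero_le_one hs hO (by simp)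
  have h1 : LSeries (fun n => ((1 : ℝ) : ℂ)) s = riemannZeta s := by
    rw [← LSeries_one_eq_riemannZeta hs]
    congr 1
  rw [← h1, h, mellin_fractCut_neg]
  have hre : (-(s + 1)).re < -1 := by simp; linarith
  have hre' : (-s).re < -1 := by simp; linarith
  have hint : ∫ x : ℝ in Set.Ioi 1, (x : ℂ) ^ (-s) = 1 / (s - 1) := by
    rw [integral_Ioi_cpow_of_lt hre' one_pos, ofReal_one, Complex.one_cpow,
      show -s + 1 = -(s - 1) by ring, neg_div_neg_eq]
  have hf : MeasureTheory.IntegrableOn (fun x : ℝ => ((Int.fract x : ℝ) : ℂ) * (x : ℂ) ^ (-(s + 1)))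
      (Set.Ioi 1) := by
    refine (integrableOn_Ioi_cpow_of_lt hre one_pos).bdd_mul (c := 1)
      (Complex.measurable_ofReal.comp measurable_fract).aestronglyMeasurable
      (MeasureTheory.ae_of_all _ fun x => ?_)
    rw [Complex.norm_real, Real.norm_of_nonneg (Int.fract_nonneg x)]
    exact (Int.fract_lt_one x).le
  have hsplit : ∫ x : ℝ in Set.Ioi 1, (∑ k ∈ Finset.Icc 1 ⌊x⌋₊, ((1 : ℝ) : ℂ)) *
      (x : ℂ) ^ (-(s + 1)) = 1 / (s - 1) -
        ∫ x : ℝ in Set.Ioi 1, ((Int.fract x : ℝ) : ℂ) * (x : ℂ) ^ (-(s + 1)) := by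
    rw [← hint, ← MeasureTheory.integral_sub (integrableOn_Ioi_cpow_of_lt hre' one_pos) hf]
    refine MeasureTheory.setIntegral_congr_fun measurableSet_Ioi fun x hx => ?_
    have hx0 : (0 : ℝ) < x := one_pos.trans hx
    have hxc : (x : ℂ) ≠ 0 := by exact_mod_cast hx0.ne'
    have hfl : ((⌊x⌋₊ : ℕ) : ℂ) = x - ((Int.fract x : ℝ) : ℂ) := by
      have : ((⌊x⌋₊ : ℕ) : ℝ) = x - (Int.fract x : ℝ) := by
        rw [natCast_floor_eq_intCast_floor hx0.le, Int.self_sub_fract]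
      exact_mod_cast congrArg ofReal this
    have hp : (x : ℂ) ^ (-s) = x * (x : ℂ) ^ (-(s + 1)) := by
      rw [show -s = 1 + -(s + 1) by ring, Complex.cpow_add _ _ hxc, Complex.cpow_one]
    simp only [ofReal_one, Finset.sum_const, Nat.card_Icc, add_tsub_cancel_right, nsmul_eq_mul,
      mul_one]
    rw [hfl, hp]
    ring
  rw [hsplit]
  ring

lemma riemannZeta_eq_of_re_pos {s : ℂ} (hs : 0 < s.re) (hs1 : s ≠ 1) :
    riemannZeta s = s / (s - 1) - s * mellin fractCut (-s) := by
  have hopen : IsOpen {s : ℂ | 0 < s.re} := isOpen_lt continuous_const Complex.continuous_re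
  have hpre : IsPreconnected {s : ℂ | 0 < s.re} := (convex_halfSpace_re_gt 0).isPreconnected
  have h1 : AnalyticOnNhd ℂ riemannZeta₁ {s : ℂ | 0 < s.re} :=
    differentiable_riemannZeta₁.differentiableOn.analyticOnNhd hopen
  have h2 : AnalyticOnNhd ℂ (fun s => s - (s - 1) * s * mellin fractCut (-s))
      {s : ℂ | 0 < s.re} := by
    refine DifferentiableOn.analyticOnNhd (fun z hz => ?_) hopen
    have hz' : (-z).re < 0 := by simpa using hz
    have hd : DifferentiableAt ℂ (fun s => mellin fractCut (-s)) z :=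
      (differentiableAt_mellin_fractCut hz').comp z differentiableAt_id.neg
    exact DifferentiableAt.differentiableWithinAt (by fun_prop)
  have hev : riemannZeta₁ =ᶠ[nhds 2] fun s => s - (s - 1) * s * mellin fractCut (-s) := by
    have : {s : ℂ | 1 < s.re} ∈ nhds (2 : ℂ) :=
      (isOpen_lt continuous_const Complex.continuous_re).mem_nhds (by simp)
    filter_upwards [this] with z hz
    have hz1 : z - 1 ≠ 0 := by
      rw [sub_ne_zero]
      rintro rfl
      simp at hz
    have h3 := riemannZeta_eq_of_one_lt_re hz
    rw [riemannZeta_eq_inv_sub_mul (sub_ne_zero.mp hz1)] at h3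
    field_simp at h3
    rw [h3]
    ring
  have h := h1.eqOn_of_preconnected_of_eventuallyEq h2 hpre (z₀ := 2) (by simp) hev hs
  have hs1' : s - 1 ≠ 0 := sub_ne_zero.mpr hs1
  rw [riemannZeta_eq_inv_sub_mul hs1, h]
  field_simp

lemma norm_riemannZeta_le {s : ℂ} (hs : 0 < s.re) (hs1 : s ≠ 1) :
    ‖riemannZeta s‖ ≤ ‖s‖ / ‖s - 1‖ + ‖s‖ / s.re := by
  rw [riemannZeta_eq_of_re_pos hs hs1]
  refine (norm_sub_le _ _).trans ?_
  rw [norm_div, norm_mul, div_eq_mul_one_div ‖s‖ s.re]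
  gcongr
  exact norm_mellin_fractCut_neg_le hs

lemma norm_Gamma_quarter_le (y : ℝ) :
    ‖Complex.Gamma (1 / 4 + I * y)‖ ≤ 4 * ‖Complex.Gamma (3 / 4 + I * y)‖ := by
  have hu : 0 < (1 / 4 + I * y : ℂ).re := by norm_num
  have hv : 0 < (1 / 2 : ℂ).re := by norm_num
  have hu' : 0 < (1 / 4 : ℂ).re := by norm_num
  have h1 := Complex.Gamma_mul_Gamma_eq_betaIntegral hu hv
  have h2 := Complex.Gamma_mul_Gamma_eq_betaIntegral hu' hv
  rw [show (1 / 4 + I * y + 1 / 2 : ℂ) = 3 / 4 + I * y by ring] at h1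
  rw [show (1 / 4 + 1 / 2 : ℂ) = 3 / 4 by norm_num] at h2
  have hB : ‖betaIntegral (1 / 4 + I * y) (1 / 2)‖ ≤ ‖betaIntegral (1 / 4) (1 / 2)‖ := by
    have hnorm : ∀ x ∈ Set.Ioc (0 : ℝ) 1, ∀ z : ℂ, z.re = 1 / 4 →
        ‖(x : ℂ) ^ (z - 1) * (1 - (x : ℂ)) ^ ((1 / 2 : ℂ) - 1)‖ =
          x ^ (-(3 / 4) : ℝ) * ‖(1 - (x : ℂ)) ^ ((1 / 2 : ℂ) - 1)‖ := by
      intro x hx z hz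
      rw [norm_mul, Complex.norm_cpow_eq_rpow_re_of_pos hx.1]
      congr 2
      rw [Complex.sub_re, hz]
      norm_num
    have hreal : ‖betaIntegral (1 / 4) (1 / 2)‖ = ∫ x : ℝ in (0 : ℝ)..1,
        x ^ (-(3 / 4) : ℝ) * ‖(1 - (x : ℂ)) ^ ((1 / 2 : ℂ) - 1)‖ := by
      have : betaIntegral (1 / 4) (1 / 2) = ((∫ x : ℝ in (0 : ℝ)..1,
          x ^ (-(3 / 4) : ℝ) * ‖(1 - (x : ℂ)) ^ ((1 / 2 : ℂ) - 1)‖ : ℝ) : ℂ) := by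
        rw [betaIntegral, ← intervalIntegral.integral_ofReal]
        refine intervalIntegral.integral_congr fun x hx => ?_
        rw [Set.uIcc_of_le zero_le_one] at hx
        have e1 : (x : ℂ) ^ ((1 / 4 : ℂ) - 1) = ((x ^ (-(3 / 4) : ℝ) : ℝ) : ℂ) := by
          rw [Complex.ofReal_cpow hx.1]
          norm_num
        have e2 : (1 - (x : ℂ)) ^ ((1 / 2 : ℂ) - 1) = (((1 - x) ^ (-(1 / 2) : ℝ) : ℝ) : ℂ) := by
          rw [Complex.ofReal_cpow (by linarith [hx.2])]
          norm_num
        simp only [e1, e2, Complex.norm_real]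
        rw [Real.norm_of_nonneg (Real.rpow_nonneg (by linarith [hx.2]) _)]
        push_cast
        ring
      rw [this, Complex.norm_real, Real.norm_of_nonneg]
      refine intervalIntegral.integral_nonneg zero_le_one fun x hx => ?_
      exact mul_nonneg (Real.rpow_nonneg hx.1 _) (norm_nonneg _)
    rw [hreal]
    refine (intervalIntegral.norm_integral_le_integral_norm zero_le_one).trans (le_of_eq ?_)
    refine intervalIntegral.integral_congr_ae (MeasureTheory.ae_of_all _ fun x hx => ?_)
    rw [Set.uIoc_of_le zero_le_one] at hx
    exact hnorm x hx _ (by norm_num)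
  have hG14 : ‖Complex.Gamma (1 / 4)‖ ≤ 4 := by
    have e : (1 / 4 : ℂ) = ((1 / 4 : ℝ) : ℂ) := by norm_num
    rw [e, Complex.Gamma_ofReal, Complex.norm_real,
      Real.norm_of_nonneg (Real.Gamma_pos_of_pos (by norm_num)).le]
    have h3 : Real.Gamma (1 / 4 + 1) = 1 / 4 * Real.Gamma (1 / 4) :=
      Real.Gamma_add_one (by norm_num)
    have h4 := Real.convexOn_Gamma.2 (Set.mem_Ioi.mpr (one_pos : (0 : ℝ) < 1))
      (Set.mem_Ioi.mpr (two_pos : (0 : ℝ) < 2)) (by norm_num : (0 : ℝ) ≤ 3 / 4)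
      (by norm_num : (0 : ℝ) ≤ 1 / 4) (by norm_num)
    norm_num [Real.Gamma_two] at h4 h3
    linarith
  have hG34 : 1 ≤ ‖Complex.Gamma (3 / 4)‖ := by
    have e : (3 / 4 : ℂ) = ((3 / 4 : ℝ) : ℂ) := by norm_num
    rw [e, Complex.Gamma_ofReal, Complex.norm_real,
      Real.norm_of_nonneg (Real.Gamma_pos_of_pos (by norm_num)).le]
    have h4 := Real.convexOn_Gamma.2 (Set.mem_Ioi.mpr (by norm_num : (0 : ℝ) < 3 / 4))
      (Set.mem_Ioi.mpr (two_pos : (0 : ℝ) < 2)) (by norm_num : (0 : ℝ) ≤ 4 / 5)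
      (by norm_num : (0 : ℝ) ≤ 1 / 5) (by norm_num)
    norm_num [Real.Gamma_two] at h4
    linarith
  have hG12 : 0 < ‖Complex.Gamma (1 / 2)‖ :=
    norm_pos_iff.mpr (Complex.Gamma_ne_zero_of_re_pos (by norm_num))
  have n1 := congrArg norm h1
  have n2 := congrArg norm h2
  rw [norm_mul, norm_mul] at n1 n2
  have hb : ‖betaIntegral (1 / 4) (1 / 2)‖ ≤ 4 * ‖Complex.Gamma (1 / 2)‖ := by
    have : 1 * ‖betaIntegral (1 / 4) (1 / 2)‖ ≤ 4 * ‖Complex.Gamma (1 / 2)‖ := by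
      calc _ ≤ ‖Complex.Gamma (3 / 4)‖ * ‖betaIntegral (1 / 4) (1 / 2)‖ := by gcongr
        _ = _ := n2.symm
        _ ≤ _ := by gcongr
    linarith
  refine le_of_mul_le_mul_right ?_ hG12
  calc _ = _ := n1
    _ ≤ ‖Complex.Gamma (3 / 4 + I * y)‖ * (4 * ‖Complex.Gamma (1 / 2)‖) := by
      gcongr
      exact hB.trans hb
    _ = _ := by ring

lemma normSq_sin_quarter (y : ℝ) :
    Complex.normSq (Complex.sin (Real.pi * (1 / 4 + I * y))) = Real.cosh (2 * (Real.pi * y)) / 2 := by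
  have h : (Real.pi * (1 / 4 + I * y) : ℂ) =
      ((Real.pi / 4 : ℝ) : ℂ) + ((Real.pi * y : ℝ) : ℂ) * I := by
    push_cast
    ring
  rw [h, Complex.sin_add_mul_I, ← Complex.ofReal_sin, ← Complex.ofReal_cos, ← Complex.ofReal_sinh,
    ← Complex.ofReal_cosh, ← Complex.ofReal_mul, ← Complex.ofReal_mul, Complex.normSq_add_mul_I,
    Real.sin_pi_div_four, Real.cos_pi_div_four, Real.cosh_two_mul]
  have h2 : (√2 : ℝ) ^ 2 = 2 := Real.sq_sqrt (by norm_num)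
  rw [mul_pow, mul_pow, div_pow, h2]
  ring

lemma norm_Gamma_quarter_sq_le (y : ℝ) :
    ‖Complex.Gamma (1 / 4 + I * y)‖ ^ 2 ≤ 8 * Real.pi * Real.exp (-(Real.pi * y)) := by
  have hrefl := congrArg norm (Complex.Gamma_mul_Gamma_one_sub (1 / 4 + I * y))
  have hc : (1 - (1 / 4 + I * y) : ℂ) = starRingEnd ℂ (3 / 4 + I * y) := by
    simp only [map_add, map_div₀, map_mul, Complex.conj_ofNat, conj_I, conj_ofReal]
    ring
  rw [hc, Complex.Gamma_conj, norm_mul, Complex.norm_conj, norm_div, Complex.norm_real,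
    Real.norm_of_nonneg Real.pi_pos.le] at hrefl
  have hsin : Real.exp (Real.pi * y) / 2 ≤ ‖Complex.sin (Real.pi * (1 / 4 + I * y))‖ := by
    refine le_of_sq_le_sq ?_ (norm_nonneg _)
    rw [← Complex.normSq_eq_norm_sq, normSq_sin_quarter, Real.cosh_eq, div_pow,
      ← Real.exp_nat_mul]
    have := Real.exp_pos (-(2 * (Real.pi * y)))
    push_cast
    linarith
  have hpos : 0 < Real.exp (Real.pi * y) / 2 := by positivity
  calc ‖Complex.Gamma (1 / 4 + I * y)‖ ^ 2
      = ‖Complex.Gamma (1 / 4 + I * y)‖ * ‖Complex.Gamma (1 / 4 + I * y)‖ := sq _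
    _ ≤ ‖Complex.Gamma (1 / 4 + I * y)‖ * (4 * ‖Complex.Gamma (3 / 4 + I * y)‖) := by
      gcongr
      exact norm_Gamma_quarter_le y
    _ = 4 * (Real.pi / ‖Complex.sin (Real.pi * (1 / 4 + I * y))‖) := by rw [← hrefl]; ring
    _ ≤ 4 * (Real.pi / (Real.exp (Real.pi * y) / 2)) := by gcongr
    _ = 8 * Real.pi * Real.exp (-(Real.pi * y)) := by
      rw [Real.exp_neg]
      field_simp
      norm_num

lemma norm_Gammaℝ_half_add_le (t : ℝ) :
    ‖Gammaℝ (1 / 2 + I * t)‖ ≤ 5.02 * Real.exp (-(Real.pi * t / 4)) := by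
  have h1 : (1 / 2 + I * t : ℂ) / 2 = 1 / 4 + I * ((t / 2 : ℝ) : ℂ) := by push_cast; ring
  have h2 : ‖(Real.pi : ℂ) ^ (-(1 / 2 + I * t) / 2)‖ ≤ 1 := by
    rw [Complex.norm_cpow_eq_rpow_re_of_pos Real.pi_pos, neg_div, h1]
    refine Real.rpow_le_one_of_one_le_of_nonpos (by linarith [Real.pi_gt_three]) ?_
    norm_num
  have h3 : ‖Complex.Gamma (1 / 4 + I * ((t / 2 : ℝ) : ℂ))‖ ≤
      5.02 * Real.exp (-(Real.pi * t / 4)) := by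
    refine le_of_sq_le_sq ((norm_Gamma_quarter_sq_le (t / 2)).trans ?_) (by positivity)
    rw [mul_pow, ← Real.exp_nat_mul]
    have : (((2 : ℕ) : ℝ) * -(Real.pi * t / 4)) = -(Real.pi * (t / 2)) := by push_cast; ring
    rw [this]
    gcongr
    norm_num
    linarith [Real.pi_lt_d4]
  rw [Gammaℝ_def, norm_mul, h1]
  calc _ ≤ 1 * (5.02 * Real.exp (-(Real.pi * t / 4))) := by gcongr
    _ = _ := one_mul _

lemma abs_xiLine_le_of_nonneg {t : ℝ} (ht : 0 ≤ t) : |xiLine t| ≤ 20 * Real.exp (-(t / 2)) := by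
  have hre : (1 / 2 + I * t : ℂ).re = 1 / 2 := by norm_num
  have hz : ‖riemannZeta (1 / 2 + I * t)‖ ≤ 2 * (1 + t) := by
    refine (norm_riemannZeta_le (by rw [hre]; norm_num) (half_add_ne_one t)).trans ?_
    have hn : ‖(1 / 2 + I * t : ℂ) - 1‖ = ‖(1 / 2 + I * t : ℂ)‖ := by
      rw [← Complex.norm_conj (1 / 2 + I * t : ℂ), conj_half_add, norm_sub_rev]
    have hs : ‖(1 / 2 + I * t : ℂ)‖ ≤ 1 / 2 + t := by
      refine (norm_add_le _ _).trans (le_of_eq ?_)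
      rw [norm_mul, Complex.norm_I, Complex.norm_real, Real.norm_of_nonneg ht]
      norm_num
    rw [hn, div_self (norm_ne_zero_iff.mpr (half_add_ne_zero t)), hre]
    linarith
  have hL : |xiLine t| = ‖riemannZeta (1 / 2 + I * t)‖ * ‖Gammaℝ (1 / 2 + I * t)‖ := by
    rw [← norm_mul, riemannZeta_def_of_ne_zero (half_add_ne_zero t),
      div_mul_cancel₀ _ (Gammaℝ_half_add_ne_zero t), completedRiemannZeta_half_add,
      Complex.norm_real, Real.norm_eq_abs]
  have h1 : 1 + t ≤ 1.9 * Real.exp (t / 4) := by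
    have e1 : (1 + t) / 4 * Real.exp 1 ≤ Real.exp ((1 + t) / 4) := by
      have := Real.add_one_le_exp ((1 + t) / 4 - 1)
      rw [Real.exp_sub] at this
      have h := Real.exp_pos 1
      rw [le_div_iff₀ h] at this
      linarith
    have e2 : Real.exp ((1 + t) / 4) = Real.exp (1 / 4) * Real.exp (t / 4) := by
      rw [← Real.exp_add]
      ring_nf
    have e3 : Real.exp (1 / 4) ≤ 1.29 := by
      have h4 : Real.exp (1 / 4) ^ 4 = Real.exp 1 := by
        rw [← Real.exp_nat_mul]
        norm_num
      refine le_of_pow_le_pow_left₀ (n := 4) (by norm_num) (by norm_num) ?_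
      rw [h4]
      have := Real.exp_one_lt_d9
      norm_num
      linarith
    have e4 := Real.exp_one_gt_d9
    have e5 := Real.exp_pos (t / 4)
    rw [e2] at e1
    have e6 : Real.exp (1 / 4) * Real.exp (t / 4) ≤ 1.29 * Real.exp (t / 4) := by gcongr
    have e7 : (1 + t) / 4 * 2.7182818283 ≤ (1 + t) / 4 * Real.exp 1 := by gcongr
    linarith
  rw [hL]
  calc _ ≤ (2 * (1 + t)) * (5.02 * Real.exp (-(Real.pi * t / 4))) := by
        gcongr
        exact norm_Gammaℝ_half_add_le t
    _ ≤ (2 * (1.9 * Real.exp (t / 4))) * (5.02 * Real.exp (-(Real.pi * t / 4))) := by gcongr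
    _ = 19.076 * Real.exp (t / 4 + -(Real.pi * t / 4)) := by rw [Real.exp_add]; ring
    _ ≤ 20 * Real.exp (-(t / 2)) := by
      gcongr
      · norm_num
      · nlinarith [Real.pi_gt_three]

lemma abs_xiLine_le (t : ℝ) : |xiLine t| ≤ 20 * Real.exp (-(|t| / 2)) := by
  rcases le_total 0 t with h | h
  · rw [abs_of_nonneg h]
    exact abs_xiLine_le_of_nonneg h
  · rw [abs_of_nonpos h, ← xiLine_neg]
    exact abs_xiLine_le_of_nonneg (by linarith)

open scoped FourierTransform

/-- The theta tail `∑_{n ≥ 1} exp (-π n² x)`. -/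
noncomputable def thetaTail (x : ℝ) : ℝ := (HurwitzZeta.evenKernel 0 x - 1) / 2

lemma hasSum_thetaTail {x : ℝ} (hx : 0 < x) :
    HasSum (fun n : ℕ => Real.exp (-Real.pi * ((n : ℝ) + 1) ^ 2 * x)) (thetaTail x) := by
  have h := (HurwitzZeta.hasSum_int_evenKernel 0 hx).nat_add_neg
  have h1 : (fun n : ℕ => Real.exp (-Real.pi * (n : ℝ) ^ 2 * x)) = fun n : ℕ =>
      (Real.exp (-Real.pi * (((n : ℤ) : ℝ) + 0) ^ 2 * x) +
        Real.exp (-Real.pi * (((-(n : ℤ) : ℤ) : ℝ) + 0) ^ 2 * x)) / 2 := by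
    ext n
    push_cast
    ring_nf
  have h2 : HasSum (fun n : ℕ => Real.exp (-Real.pi * (n : ℝ) ^ 2 * x))
      ((HurwitzZeta.evenKernel 0 x + 1) / 2) := by
    rw [h1]
    simpa using h.div_const 2
  have h3 := (hasSum_nat_add_iff' 1).mpr h2
  have h4 : thetaTail x = (HurwitzZeta.evenKernel 0 x + 1) / 2 -
      ∑ i ∈ Finset.range 1, Real.exp (-Real.pi * (i : ℝ) ^ 2 * x) := by
    rw [thetaTail, Finset.sum_range_one]
    norm_num
    ring
  rw [h4]
  exact_mod_cast h3

lemma thetaTail_nonneg {x : ℝ} (hx : 0 < x) : 0 ≤ thetaTail x :=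
  (hasSum_thetaTail hx).nonneg fun _ => (Real.exp_pos _).le

lemma thetaTail_le {x : ℝ} (hx : 1 ≤ x) : thetaTail x ≤ 2 * Real.exp (-Real.pi * x) := by
  have hx0 : 0 < x := by linarith
  have hq : Real.exp (-Real.pi * x) ≤ 1 / 2 := by
    have h1 : Real.exp (-Real.pi * x) ≤ Real.exp (-1) := by
      rw [Real.exp_le_exp]
      nlinarith [Real.pi_gt_three]
    have := Real.exp_neg_one_lt_d9
    linarith
  have hg := (hasSum_geometric_of_lt_one (Real.exp_pos (-Real.pi * x)).le
    (by linarith)).mul_left (Real.exp (-Real.pi * x))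
  have h := hasSum_le (fun n => ?_) (hasSum_thetaTail hx0) hg
  · refine h.trans ?_
    rw [mul_comm (2 : ℝ)]
    gcongr
    rw [inv_le_comm₀ (by linarith) two_pos]
    linarith
  · rw [← Real.exp_nat_mul, ← Real.exp_add, Real.exp_le_exp]
    have : 0 < Real.pi * x := by positivity
    nlinarith [sq_nonneg (n : ℝ), mul_nonneg this.le (Nat.cast_nonneg (α := ℝ) n),
      mul_nonneg this.le (sq_nonneg (n : ℝ))]

lemma continuousOn_thetaTail : ContinuousOn thetaTail (Set.Ioi 0) :=
  ((HurwitzZeta.continuousOn_evenKernel 0).sub continuousOn_const).div_const 2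

/-- The theta part of the even kernel whose Fourier transform is the completed zeta function. -/
noncomputable def thetaKer (v : ℝ) : ℝ := 2 * Real.exp (|v| / 4) * thetaTail (Real.exp |v|)

/-- The even kernel whose Fourier transform is the completed zeta function. -/
noncomputable def xiKer (v : ℝ) : ℝ := thetaKer v - Real.exp (-(|v| / 4))

lemma continuous_thetaKer : Continuous thetaKer := by
  have : Continuous fun v : ℝ => thetaTail (Real.exp |v|) :=
    continuousOn_thetaTail.comp_continuous (by fun_prop) fun v => Real.exp_pos _
  unfold thetaKer
  fun_prop

lemma continuous_xiKer : Continuous xiKer :=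
  continuous_thetaKer.sub (by fun_prop)

lemma thetaKer_nonneg (v : ℝ) : 0 ≤ thetaKer v :=
  mul_nonneg (by positivity) (thetaTail_nonneg (Real.exp_pos _))

lemma thetaKer_le (v : ℝ) : thetaKer v ≤ 4 * Real.exp (-(|v| / 4)) := by
  have h0 := abs_nonneg v
  have h1 : Real.pi * Real.exp |v| ≥ |v| := by
    have := Real.add_one_le_exp |v|
    nlinarith [Real.pi_gt_three]
  calc thetaKer v ≤ 2 * Real.exp (|v| / 4) * (2 * Real.exp (-Real.pi * Real.exp |v|)) := by
        unfold thetaKer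
        gcongr
        exact thetaTail_le (Real.one_le_exp h0)
    _ = 4 * Real.exp (|v| / 4 + -Real.pi * Real.exp |v|) := by rw [Real.exp_add]; ring
    _ ≤ _ := by
      gcongr
      linarith

lemma abs_xiKer_le (v : ℝ) : |xiKer v| ≤ 4 * Real.exp (-(|v| / 4)) := by
  have h1 := thetaKer_nonneg v
  have h2 := thetaKer_le v
  have h3 := Real.exp_pos (-(|v| / 4))
  rw [xiKer, abs_le]
  constructor <;> linarith

lemma integrable_exp_neg_abs_div : MeasureTheory.Integrable fun v : ℝ => Real.exp (-(|v| / 4)) := by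
  rw [← MeasureTheory.integrableOn_univ, ← Set.Iic_union_Ioi (a := (0 : ℝ))]
  refine MeasureTheory.IntegrableOn.union ?_ ?_
  · refine (integrableOn_exp_mul_Iic (a := 1 / 4) (by norm_num) 0).congr_fun (fun v hv => ?_)
      measurableSet_Iic
    simp only [abs_of_nonpos (Set.mem_Iic.mp hv)]
    ring_nf
  · refine (integrableOn_exp_mul_Ioi (a := -(1 / 4)) (by norm_num) 0).congr_fun (fun v hv => ?_)
      measurableSet_Ioi
    simp only [abs_of_pos (Set.mem_Ioi.mp hv)]
    ring_nf

lemma integrable_thetaKer : MeasureTheory.Integrable thetaKer := by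
  refine (integrable_exp_neg_abs_div.const_mul 4).mono'
    continuous_thetaKer.aestronglyMeasurable (MeasureTheory.ae_of_all _ fun v => ?_)
  rw [Real.norm_of_nonneg (thetaKer_nonneg v)]
  exact thetaKer_le v

lemma fourier_exp_neg_abs (t : ℝ) :
    𝓕 (fun v : ℝ => ((Real.exp (-(|v| / 4)) : ℝ) : ℂ)) (t / (4 * Real.pi)) =
      2 * (1 / (1 / 2 + I * t) + 1 / (1 - (1 / 2 + I * t))) := by
  rw [Real.fourier_real_eq_integral_exp_smul]
  have hpi := Real.pi_ne_zero
  have hpic : (Real.pi : ℂ) ≠ 0 := by exact_mod_cast hpi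
  have e : ∀ v : ℝ, Complex.exp (((-2 * Real.pi * v * (t / (4 * Real.pi)) : ℝ) : ℂ) * I) •
      ((Real.exp (-(|v| / 4)) : ℝ) : ℂ) =
        Complex.exp (-(|v| / 4 : ℝ) - I * t / 2 * v) := by
    intro v
    rw [smul_eq_mul, Complex.ofReal_exp, ← Complex.exp_add]
    congr 1
    push_cast
    field_simp
    ring
  simp_rw [e]
  have i1 : Set.EqOn (fun v : ℝ => Complex.exp (-(|v| / 4 : ℝ) - I * t / 2 * v))
      (fun v : ℝ => Complex.exp ((1 / 4 - I * t / 2) * v)) (Set.Iic 0) := by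
    intro v hv
    simp only [abs_of_nonpos (Set.mem_Iic.mp hv)]
    push_cast
    ring_nf
  have i2 : Set.EqOn (fun v : ℝ => Complex.exp (-(|v| / 4 : ℝ) - I * t / 2 * v))
      (fun v : ℝ => Complex.exp ((-(1 / 4) - I * t / 2) * v)) (Set.Ioi 0) := by
    intro v hv
    simp only [abs_of_pos (Set.mem_Ioi.mp hv)]
    push_cast
    ring_nf
  have r1 : 0 < (1 / 4 - I * t / 2 : ℂ).re := by norm_num
  have r2 : (-(1 / 4) - I * t / 2 : ℂ).re < 0 := by norm_num
  rw [← intervalIntegral.integral_Iic_add_Ioi (b := (0 : ℝ))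
    ((integrableOn_exp_mul_complex_Iic r1 0).congr_fun i1.symm measurableSet_Iic)
    ((integrableOn_exp_mul_complex_Ioi r2 0).congr_fun i2.symm measurableSet_Ioi),
    MeasureTheory.setIntegral_congr_fun measurableSet_Iic i1,
    MeasureTheory.setIntegral_congr_fun measurableSet_Ioi i2,
    integral_exp_mul_complex_Iic r1, integral_exp_mul_complex_Ioi r2]
  have n1 : (1 / 4 - I * t / 2 : ℂ) ≠ 0 := fun h => by rw [h, zero_re] at r1; exact lt_irrefl _ r1
  have n2 : (-(1 / 4) - I * t / 2 : ℂ) ≠ 0 := fun h => by rw [h, zero_re] at r2; exact lt_irrefl _ r2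
  have n3 := half_add_ne_zero t
  have n4 : (1 - (1 / 2 + I * t) : ℂ) ≠ 0 := sub_ne_zero.mpr (half_add_ne_one t).symm
  simp only [ofReal_zero, mul_zero, Complex.exp_zero]
  have h1 : (1 / 4 - I * t / 2 : ℂ) = (1 - (1 / 2 + I * t)) / 2 := by ring
  have h2 : (-(1 / 4) - I * t / 2 : ℂ) = -((1 / 2 + I * t) / 2) := by ring
  rw [h1, h2, neg_div_neg_eq, one_div_div, one_div_div]
  ring

lemma fourier_thetaKer (t : ℝ) :
    𝓕 (fun v : ℝ => (thetaKer v : ℂ)) (t / (4 * Real.pi)) =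
      2 * completedRiemannZeta₀ (1 / 2 + I * t) := by
  have hs : (1 / 2 + I * t : ℂ) / 2 = 1 / 4 + I * ((t / 2 : ℝ) : ℂ) := by push_cast; ring
  have hre : ((1 / 2 + I * t : ℂ) / 2).re = 1 / 4 := by rw [hs]; norm_num
  have him : ((1 / 2 + I * t : ℂ) / 2).im / (2 * Real.pi) = t / (4 * Real.pi) := by
    rw [hs]
    have : (1 / 4 + I * ((t / 2 : ℝ) : ℂ)).im = t / 2 := by norm_num
    rw [this]
    ring
  have h0 : completedRiemannZeta₀ (1 / 2 + I * t) =
      mellin (HurwitzZeta.hurwitzEvenFEPair 0).f_modif ((1 / 2 + I * t) / 2) / 2 := rfl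
  rw [h0, mellin_eq_fourier, hre, him, mul_div_cancel₀ _ two_ne_zero,
    Real.fourier_real_eq_integral_exp_smul, Real.fourier_real_eq_integral_exp_smul]
  refine MeasureTheory.integral_congr_ae ?_
  have hne : ∀ᵐ v : ℝ, v ≠ 0 := by
    simp [MeasureTheory.ae_iff]
  filter_upwards [hne] with v hv
  congr 1
  have hf : (HurwitzZeta.hurwitzEvenFEPair 0).f = ofReal ∘ HurwitzZeta.evenKernel 0 := rfl
  have hf0 : (HurwitzZeta.hurwitzEvenFEPair 0).f₀ = 1 := by
    simp [HurwitzZeta.hurwitzEvenFEPair]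
  have hg0 : (HurwitzZeta.hurwitzEvenFEPair 0).g₀ = 1 := by
    simp [HurwitzZeta.hurwitzEvenFEPair]
  have hε : (HurwitzZeta.hurwitzEvenFEPair 0).ε = 1 := rfl
  have hk : (HurwitzZeta.hurwitzEvenFEPair 0).k = 1 / 2 := rfl
  rcases lt_or_gt_of_ne hv with hv | hv
  · have m1 : Real.exp (-v) ∈ Set.Ioi (1 : ℝ) := Real.one_lt_exp_iff.mpr (by linarith)
    have m2 : Real.exp (-v) ∉ Set.Ioo (0 : ℝ) 1 := fun h => lt_asymm h.2 m1
    rw [WeakFEPair.f_modif, Pi.add_apply, Set.indicator_of_mem m1, Set.indicator_of_notMem m2,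
      hf, hf0, thetaKer, thetaTail, abs_of_neg hv, Complex.real_smul, Function.comp_apply]
    push_cast
    ring_nf
  · have m1 : Real.exp (-v) ∉ Set.Ioi (1 : ℝ) :=
      fun h => lt_asymm (Real.one_lt_exp_iff.mp h) (by linarith)
    have m2 : Real.exp (-v) ∈ Set.Ioo (0 : ℝ) 1 := ⟨Real.exp_pos _, by simpa using hv⟩
    have hmod : HurwitzZeta.evenKernel 0 (Real.exp (-v)) =
        Real.exp (v / 2) * HurwitzZeta.evenKernel 0 (Real.exp v) := by
      rw [HurwitzZeta.evenKernel_functional_equation, ← HurwitzZeta.evenKernel_eq_cosKernel_of_zero,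
        ← Real.exp_mul, one_div (Real.exp (-v)), one_div (Real.exp _), ← Real.exp_neg,
        ← Real.exp_neg]
      ring_nf
    have hpow : Real.exp (-v) ^ (-(1 / 2) : ℝ) = Real.exp (v / 2) := by
      rw [← Real.exp_mul]
      ring_nf
    have hsplit : Real.exp (v / 4) = Real.exp (-(1 / 4) * v) * Real.exp (v / 2) := by
      rw [← Real.exp_add]
      ring_nf
    rw [WeakFEPair.f_modif, Pi.add_apply, Set.indicator_of_notMem m1, Set.indicator_of_mem m2,
      hf, hg0, hε, hk, hpow, thetaKer, thetaTail, abs_of_pos hv, Complex.real_smul,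
      Function.comp_apply, hmod, hsplit]
    push_cast
    simp only [smul_eq_mul]
    ring

lemma fourier_xiKer (t : ℝ) :
    𝓕 (fun v : ℝ => (xiKer v : ℂ)) (t / (4 * Real.pi)) = 2 * (xiLine t : ℂ) := by
  have h : (fun v : ℝ => (xiKer v : ℂ)) = (fun v : ℝ => (thetaKer v : ℂ)) -
      fun v : ℝ => ((Real.exp (-(|v| / 4)) : ℝ) : ℂ) := by
    ext v
    simp [xiKer]
  have h2 : 𝓕 (fun v : ℝ => (xiKer v : ℂ)) (t / (4 * Real.pi)) =
      𝓕 (fun v : ℝ => (thetaKer v : ℂ)) (t / (4 * Real.pi)) -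
        𝓕 (fun v : ℝ => ((Real.exp (-(|v| / 4)) : ℝ) : ℂ)) (t / (4 * Real.pi)) := by
    rw [h, Real.fourier_eq, Real.fourier_eq, Real.fourier_eq, ← MeasureTheory.integral_sub]
    · simp only [Pi.sub_apply, smul_sub]
    · exact (Real.fourierIntegral_convergent_iff _).mpr integrable_thetaKer.ofReal
    · exact (Real.fourierIntegral_convergent_iff _).mpr integrable_exp_neg_abs_div.ofReal
  rw [h2, fourier_thetaKer, fourier_exp_neg_abs, ← completedRiemannZeta_half_add,
    completedRiemannZeta_eq]
  ring

lemma thetaKer_mul_log {r : ℝ} (hr : 1 < r) (n : ℕ) :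
    thetaKer (4 * Real.log r * n) = 2 * (r ^ n * thetaTail (r ^ (4 * n))) := by
  have hr0 : 0 < r := by linarith
  have hl : 0 < Real.log r := Real.log_pos hr
  have h1 : Real.exp (4 * Real.log r * n / 4) = r ^ n := by
    rw [show 4 * Real.log r * n / 4 = n * Real.log r by ring, Real.exp_nat_mul, Real.exp_log hr0]
  have h2 : Real.exp (4 * Real.log r * n) = r ^ (4 * n) := by
    rw [show 4 * Real.log r * n = ((4 * n : ℕ) : ℝ) * Real.log r by push_cast; ring,
      Real.exp_nat_mul, Real.exp_log hr0]
  rw [thetaKer, abs_of_nonneg (by positivity), h1, h2]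
  ring

lemma exp_neg_mul_log {r : ℝ} (hr : 1 < r) (n : ℕ) :
    Real.exp (-(|4 * Real.log r * n| / 4)) = (r⁻¹) ^ n := by
  have hr0 : 0 < r := by linarith
  have hl : 0 < Real.log r := Real.log_pos hr
  rw [abs_of_nonneg (by positivity), show -(4 * Real.log r * n / 4) = n * (-Real.log r) by ring,
    Real.exp_nat_mul, Real.exp_neg, Real.exp_log hr0]

lemma isBigO_exp_neg_abs {h : ℝ} (hh : 0 < h) :
    (fun x : ℝ => Real.exp (-(|h * x| / 4))) =O[Filter.cocompact ℝ] fun x => |x| ^ (-2 : ℝ) := by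
  have h1 := (isLittleO_exp_neg_mul_rpow_atTop (a := h / 4) (by positivity) (-2)).isBigO
  have h2 := h1.comp_tendsto (tendsto_norm_cocompact_atTop (E := ℝ))
  refine h2.congr_left fun x => ?_
  rw [Function.comp_apply, Real.norm_eq_abs, abs_mul, abs_of_pos hh]
  ring_nf

lemma fourier_modulated_xiKer {h : ℝ} (hh : 0 < h) (n : ℤ) :
    𝓕 (fun x : ℝ => (xiKer (h * x) : ℂ) * Complex.exp (-(Real.pi * x * I))) (n : ℝ) =
      2 / h * (xiLine ((2 * n + 1) * (2 * Real.pi / h)) : ℂ) := by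
  have hhc : (h : ℂ) ≠ 0 := by exact_mod_cast hh.ne'
  have hpi := Real.pi_ne_zero
  have key := fourier_xiKer ((2 * n + 1) * (2 * Real.pi / h))
  have harg : (2 * n + 1) * (2 * Real.pi / h) / (4 * Real.pi) = (n + 1 / 2) / h := by
    field_simp
    ring
  rw [harg, Real.fourier_real_eq_integral_exp_smul] at key
  have hcv := MeasureTheory.Measure.integral_comp_mul_left (fun v : ℝ =>
    Complex.exp (((-2 * Real.pi * v * ((n + 1 / 2) / h) : ℝ) : ℂ) * I) • (xiKer v : ℂ)) h
  rw [key, abs_of_pos (inv_pos.mpr hh)] at hcv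
  rw [Real.fourier_real_eq_integral_exp_smul]
  have e : ∀ x : ℝ, Complex.exp (((-2 * Real.pi * x * n : ℝ) : ℂ) * I) •
      ((xiKer (h * x) : ℂ) * Complex.exp (-(Real.pi * x * I))) =
      Complex.exp (((-2 * Real.pi * (h * x) * ((n + 1 / 2) / h) : ℝ) : ℂ) * I) •
        (xiKer (h * x) : ℂ) := by
    intro x
    rw [smul_eq_mul, smul_eq_mul, mul_comm (xiKer (h * x) : ℂ), ← mul_assoc, ← Complex.exp_add]
    congr 2
    push_cast
    field_simp
    ring
  simp_rw [e]
  rw [hcv, Complex.real_smul]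
  push_cast
  ring

lemma summable_xiLine_odd {τ : ℝ} (hτ : 0 < τ) :
    Summable fun n : ℕ => xiLine ((2 * n + 1) * τ) := by
  have hq : Real.exp (-τ) < 1 := by simpa using hτ
  refine Summable.of_norm_bounded
    ((summable_geometric_of_lt_one (Real.exp_pos _).le hq).mul_left
      (20 * Real.exp (-(τ / 2)))) fun n => ?_
  refine (abs_xiLine_le _).trans (le_of_eq ?_)
  rw [abs_of_nonneg (by positivity), ← Real.exp_nat_mul, mul_assoc, ← Real.exp_add]
  ring_nf

lemma xiKer_even (v : ℝ) : xiKer (-v) = xiKer v := by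
  simp [xiKer, thetaKer]

lemma summable_rpow_thetaTail {r : ℝ} (hr : 1 < r) :
    Summable fun n : ℕ => (-1) ^ n * (r ^ n * thetaTail (r ^ (4 * n))) := by
  have hr0 : 0 < r := by linarith
  have hr1 : r⁻¹ < 1 := inv_lt_one_of_one_lt₀ hr
  refine Summable.of_norm_bounded
    ((summable_geometric_of_lt_one (inv_pos.mpr hr0).le hr1).mul_left 2) fun n => ?_
  have h1 := thetaKer_le (4 * Real.log r * n)
  have h2 : 0 ≤ thetaTail (r ^ (4 * n)) := thetaTail_nonneg (by positivity)
  rw [exp_neg_mul_log hr, thetaKer_mul_log hr] at h1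
  rw [norm_mul, norm_pow, norm_neg, norm_one, one_pow, one_mul,
    Real.norm_of_nonneg (by positivity)]
  linarith

/-- Poisson summation for the kernel of the completed zeta function along the progression
`4 n log r`, with alternating signs. -/
lemma alternating_theta_eq {r : ℝ} (hr : 1 < r) :
    4 * ∑' n : ℕ, (-1) ^ n * (r ^ n * thetaTail (r ^ (4 * n))) - 2 * thetaTail 1 +
      (1 - r) / (1 + r) =
        (∑' n : ℕ, xiLine ((2 * n + 1) * (Real.pi / (2 * Real.log r)))) / Real.log r := by
  have hr0 : 0 < r := by linarith
  have hl : 0 < Real.log r := Real.log_pos hr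
  set h := 4 * Real.log r with hh
  have hhpos : 0 < h := by positivity
  set τ := Real.pi / (2 * Real.log r) with hτ
  have hτpos : 0 < τ := by have := Real.pi_pos; positivity
  have hτh : 2 * Real.pi / h = τ := by rw [hτ, hh]; field_simp; ring
  set f : ℝ → ℂ := fun x => (xiKer (h * x) : ℂ) * Complex.exp (-(Real.pi * x * I)) with hf
  have hcont : Continuous f := by
    have := continuous_xiKer
    fun_prop
  have hnorm : ∀ x, ‖f x‖ = |xiKer (h * x)| := by
    intro x
    rw [hf]
    simp only [norm_mul, Complex.norm_real, Real.norm_eq_abs]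
    rw [show (-(Real.pi * x * I) : ℂ) = ((-(Real.pi * x) : ℝ) : ℂ) * I by push_cast; ring,
      Complex.norm_exp_ofReal_mul_I, mul_one]
  have hdecay : f =O[Filter.cocompact ℝ] fun x => |x| ^ (-2 : ℝ) := by
    refine Asymptotics.IsBigO.trans (Asymptotics.IsBigO.of_bound 4
      (Filter.Eventually.of_forall fun x => ?_)) (isBigO_exp_neg_abs hhpos)
    rw [hnorm, Real.norm_of_nonneg (Real.exp_pos _).le]
    exact abs_xiKer_le _
  have hfour : ∀ n : ℤ, 𝓕 f (n : ℝ) = ((2 / h * xiLine ((2 * n + 1) * τ) : ℝ) : ℂ) := by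
    intro n
    rw [hf, fourier_modulated_xiKer hhpos, hτh]
    push_cast
    rfl
  set g : ℤ → ℝ := fun n => 2 / h * xiLine ((2 * n + 1) * τ) with hg
  have hsum := summable_xiLine_odd hτpos
  have hgsum : HasSum g (2 / h * (∑' n : ℕ, xiLine ((2 * n + 1) * τ)) +
      2 / h * (∑' n : ℕ, xiLine ((2 * n + 1) * τ))) := by
    refine HasSum.of_nat_of_neg_add_one ?_ ?_
    · simpa [hg] using hsum.hasSum.mul_left (2 / h)
    · have e : (fun n : ℕ => g (-((n : ℤ) + 1))) =
          fun n : ℕ => 2 / h * xiLine ((2 * n + 1) * τ) := by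
        ext n
        simp only [hg]
        rw [← xiLine_neg ((2 * n + 1) * τ)]
        push_cast
        ring_nf
      rw [e]
      exact hsum.hasSum.mul_left (2 / h)
  have hFsum : Summable fun n : ℤ => 𝓕 f (n : ℝ) := by
    simp_rw [hfour]
    exact Complex.summable_ofReal.mpr hgsum.summable
  have hpois := Real.tsum_eq_tsum_fourier_of_rpow_decay_of_summable hcont (b := 2) (by norm_num)
    hdecay hFsum 0
  have hexp : ∀ n : ℕ, Complex.exp (-(Real.pi * (n : ℂ) * I)) = (-1) ^ n := by
    intro n
    rw [show -(Real.pi * (n : ℂ) * I) = n * (-(Real.pi * I)) by ring, Complex.exp_nat_mul,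
      Complex.exp_neg, Complex.exp_pi_mul_I]
    norm_num
  have hexp' : ∀ n : ℕ, Complex.exp (Real.pi * (n : ℂ) * I) = (-1) ^ n := by
    intro n
    rw [show Real.pi * (n : ℂ) * I = n * (Real.pi * I) by ring, Complex.exp_nat_mul,
      Complex.exp_pi_mul_I]
  set k : ℕ → ℝ := fun n => (-1) ^ n * xiKer (h * n) with hk
  have hfk : ∀ n : ℕ, f ((n : ℤ) : ℝ) = (k n : ℂ) := by
    intro n
    simp only [hf, hk]
    push_cast
    rw [hexp, mul_comm]
  have hfk' : ∀ n : ℕ, f ((-(n : ℤ) : ℤ) : ℝ) = (k n : ℂ) := by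
    intro n
    simp only [hf, hk]
    push_cast
    rw [mul_neg, xiKer_even, show -(Real.pi * -(n : ℂ) * I) = Real.pi * (n : ℂ) * I by ring,
      hexp', mul_comm]
  have hksum : HasSum k (2 * ∑' n : ℕ, (-1) ^ n * (r ^ n * thetaTail (r ^ (4 * n))) -
      r / (1 + r)) := by
    have h1 := (summable_rpow_thetaTail hr).hasSum.mul_left 2
    have h2 := hasSum_geometric_of_abs_lt_one (r := -r⁻¹) (by
      rw [abs_neg, abs_of_pos (inv_pos.mpr hr0)]
      exact inv_lt_one_of_one_lt₀ hr)
    have e2 : (1 - -r⁻¹)⁻¹ = r / (1 + r) := by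
      have : 1 + r ≠ 0 := by linarith
      rw [sub_neg_eq_add, inv_eq_iff_eq_inv, inv_div]
      field_simp
      ring
    rw [e2] at h2
    refine (h1.sub h2).congr_fun ?_
    intro n
    simp only [hk]
    rw [xiKer, exp_neg_mul_log hr, thetaKer_mul_log hr, neg_pow]
    ring
  have hint : HasSum (fun n : ℤ => f (n : ℝ)) (((2 * (2 * ∑' n : ℕ, (-1) ^ n *
      (r ^ n * thetaTail (r ^ (4 * n))) - r / (1 + r)) - k 0 : ℝ)) : ℂ) := by
    have s1 : Summable fun n : ℕ => f ((n : ℤ) : ℝ) := by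
      simp_rw [hfk]
      exact Complex.summable_ofReal.mpr hksum.summable
    have s2 : Summable fun n : ℕ => f ((-(n : ℤ) : ℤ) : ℝ) := by
      simp_rw [hfk']
      exact Complex.summable_ofReal.mpr hksum.summable
    have s : Summable fun n : ℤ => f (n : ℝ) := Summable.of_nat_of_neg s1 s2
    have a1 := s.hasSum.nat_add_neg
    have a2 : HasSum (fun n : ℕ => f ((n : ℤ) : ℝ) + f ((-(n : ℤ) : ℤ) : ℝ))
        ((2 * (2 * ∑' n : ℕ, (-1) ^ n * (r ^ n * thetaTail (r ^ (4 * n))) - r / (1 + r)) : ℝ) :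
          ℂ) := by
      simp_rw [hfk, hfk', ← two_mul]
      exact_mod_cast hksum.mul_left 2
    have a3 := a1.unique a2
    have a4 : f ((0 : ℤ) : ℝ) = (k 0 : ℂ) := hfk 0
    rw [a4] at a3
    have a5 : ∑' n : ℤ, f (n : ℝ) = (((2 * (2 * ∑' n : ℕ, (-1) ^ n *
        (r ^ n * thetaTail (r ^ (4 * n))) - r / (1 + r)) - k 0 : ℝ)) : ℂ) := by
      rw [Complex.ofReal_sub, ← a3]
      ring
    rw [← a5]
    exact s.hasSum
  have hk0 : k 0 = 2 * thetaTail 1 - 1 := by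
    simp [hk, xiKer, thetaKer]
  simp only [zero_add] at hpois
  have hz : ∀ n : ℤ, (fourier n ((0 : ℝ) : UnitAddCircle) : ℂ) = 1 := by
    intro n
    simp
  simp_rw [hz, mul_one, hfour] at hpois
  rw [hint.tsum_eq, ← Complex.ofReal_tsum, hgsum.tsum_eq, Complex.ofReal_inj, hk0, hh] at hpois
  have hfin : (1 - r) / (1 + r) = 1 - 2 * (r / (1 + r)) := by
    field_simp
    ring
  generalize (∑' n : ℕ, (-1) ^ n * (r ^ n * thetaTail (r ^ (4 * n)))) = W at *
  generalize (∑' n : ℕ, xiLine ((2 * n + 1) * τ)) = S at *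
  have hS : S / Real.log r = 2 / (4 * Real.log r) * S + 2 / (4 * Real.log r) * S := by
    field_simp
    ring
  rw [hfin, hS]
  linarith

lemma mul_thetaTail_le {u x : ℝ} (hu : 1 ≤ u) (hx : 1 ≤ x) :
    u * thetaTail (u ^ 4 * x) ≤ thetaTail x := by
  have hx0 : 0 < x := by linarith
  have hu0 : 0 < u := by linarith
  refine hasSum_le (fun n => ?_) ((hasSum_thetaTail (x := u ^ 4 * x) (by positivity)).mul_left u)
    (hasSum_thetaTail hx0)
  have h1 : u ≤ Real.exp (u - 1) := by linarith [Real.add_one_le_exp (u - 1)]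
  refine (mul_le_mul_of_nonneg_right h1 (Real.exp_pos _).le).trans ?_
  rw [← Real.exp_add, Real.exp_le_exp]
  have hn : (1 : ℝ) ≤ ((n : ℝ) + 1) ^ 2 := by
    have : (0 : ℝ) ≤ n := Nat.cast_nonneg n
    nlinarith
  have hu4 : u - 1 ≤ u ^ 4 - 1 := by
    have := le_self_pow₀ hu (n := 4) (by norm_num)
    linarith
  have hprod : 1 ≤ Real.pi * ((n : ℝ) + 1) ^ 2 * x := by
    have h2 : 1 ≤ Real.pi := by linarith [Real.pi_gt_three]
    exact one_le_mul_of_one_le_of_one_le (one_le_mul_of_one_le_of_one_le h2 hn) hx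
  have := le_mul_of_one_le_left (by linarith : (0 : ℝ) ≤ u ^ 4 - 1) hprod
  nlinarith

lemma pow_mul_thetaTail_anti {r s : ℝ} (hr : 1 ≤ r) (hrs : r ≤ s) (n : ℕ) :
    s ^ n * thetaTail (s ^ (4 * n)) ≤ r ^ n * thetaTail (r ^ (4 * n)) := by
  have hr0 : 0 < r := by linarith
  have h := mul_thetaTail_le (u := (s / r) ^ n) (x := r ^ (4 * n))
    (one_le_pow₀ ((one_le_div hr0).mpr hrs)) (one_le_pow₀ hr)
  have e : ((s / r) ^ n) ^ 4 * r ^ (4 * n) = s ^ (4 * n) := by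
    rw [← pow_mul, mul_comm n 4, ← mul_pow, div_mul_cancel₀ _ hr0.ne']
  rw [e] at h
  have h2 := mul_le_mul_of_nonneg_left h (pow_nonneg hr0.le n)
  rwa [← mul_assoc, ← mul_pow, mul_div_cancel₀ _ hr0.ne'] at h2

lemma antitone_pow_mul_thetaTail {r : ℝ} (hr : 1 ≤ r) :
    Antitone fun n : ℕ => r ^ n * thetaTail (r ^ (4 * n)) := by
  refine antitone_nat_of_succ_le fun n => ?_
  have hr0 : 0 < r := by linarith
  have h := mul_thetaTail_le hr (one_le_pow₀ (n := 4 * n) hr)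
  have h2 := mul_le_mul_of_nonneg_left h (pow_nonneg hr0.le n)
  rw [show r ^ (4 * (n + 1)) = r ^ 4 * r ^ (4 * n) by ring]
  calc _ = r ^ n * (r * thetaTail (r ^ 4 * r ^ (4 * n))) := by ring
    _ ≤ _ := h2

/-- The alternating theta sum. -/
noncomputable def altTheta (r : ℝ) : ℝ := ∑' n : ℕ, (-1) ^ n * (r ^ n * thetaTail (r ^ (4 * n)))

lemma sum_range_even_le_altTheta {r : ℝ} (hr : 1 < r) (k : ℕ) :
    ∑ n ∈ Finset.range (2 * k), (-1) ^ n * (r ^ n * thetaTail (r ^ (4 * n))) ≤ altTheta r :=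
  (antitone_pow_mul_thetaTail hr.le).alternating_series_le_tendsto
    (summable_rpow_thetaTail hr).hasSum.tendsto_sum_nat k

lemma altTheta_le_sum_range_odd {r : ℝ} (hr : 1 < r) (k : ℕ) :
    altTheta r ≤
      ∑ n ∈ Finset.range (2 * k + 1), (-1) ^ n * (r ^ n * thetaTail (r ^ (4 * n))) :=
  (antitone_pow_mul_thetaTail hr.le).tendsto_le_alternating_series
    (summable_rpow_thetaTail hr).hasSum.tendsto_sum_nat k

/-- Sampling the completed zeta function at the single point `π / (2 log r)`. -/
lemma abs_xiLine_sub_le {r p : ℝ} (hr : 1 < r)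
    (hp : Real.exp (-(Real.pi / (2 * Real.log r) / 2)) ≤ p) (hp1 : p < 1) :
    |xiLine (Real.pi / (2 * Real.log r)) -
      (4 * altTheta r - 2 * thetaTail 1 + (1 - r) / (1 + r)) * Real.log r| ≤
        20 * p ^ 3 / (1 - p ^ 2) := by
  have hl : 0 < Real.log r := Real.log_pos hr
  rw [altTheta, alternating_theta_eq hr, div_mul_cancel₀ _ hl.ne']
  set τ := Real.pi / (2 * Real.log r) with hτ
  have hτpos : 0 < τ := by have := Real.pi_pos; positivity
  have hp0 : 0 < p := (Real.exp_pos _).trans_le hp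
  have hp2 : p ^ 2 < 1 := pow_lt_one₀ hp0.le hp1 (by norm_num)
  have hs := summable_xiLine_odd hτpos
  rw [hs.tsum_eq_zero_add]
  have e0 : xiLine ((2 * ((0 : ℕ) : ℝ) + 1) * τ) = xiLine τ := by simp
  rw [e0, sub_add_cancel_left, abs_neg]
  have hg : HasSum (fun n : ℕ => 20 * p ^ 3 * (p ^ 2) ^ n) (20 * p ^ 3 * (1 - p ^ 2)⁻¹) :=
    (hasSum_geometric_of_lt_one (by positivity) hp2).mul_left _
  rw [div_eq_mul_inv, ← Real.norm_eq_abs]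
  refine tsum_of_norm_bounded hg fun n => ?_
  rw [Real.norm_eq_abs]
  refine (abs_xiLine_le _).trans ?_
  rw [abs_of_nonneg (by positivity)]
  have : Real.exp (-((2 * ((n + 1 : ℕ) : ℝ) + 1) * τ / 2)) = Real.exp (-(τ / 2)) ^ (2 * n + 3) := by
    rw [← Real.exp_nat_mul]
    push_cast
    ring_nf
  rw [this]
  calc 20 * Real.exp (-(τ / 2)) ^ (2 * n + 3) ≤ 20 * p ^ (2 * n + 3) := by gcongr
    _ = _ := by ring

/-! ### Certified rational bounds -/

/-- Rounding down to eighteen decimals. -/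
def roundDown (x : ℚ) : ℚ := ⌊x * 10 ^ 18⌋ / 10 ^ 18

/-- Rounding up to eighteen decimals. -/
def roundUp (x : ℚ) : ℚ := (⌊x * 10 ^ 18⌋ + 1) / 10 ^ 18

lemma roundDown_le (x : ℚ) : roundDown x ≤ x := by
  rw [roundDown, div_le_iff₀ (by positivity)]
  exact Int.floor_le _

lemma le_roundUp (x : ℚ) : x ≤ roundUp x := by
  rw [roundUp, le_div_iff₀ (by positivity)]
  exact (Int.lt_floor_add_one _).le

lemma roundDown_nonneg {x : ℚ} (hx : 0 ≤ x) : 0 ≤ roundDown x := by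
  have : 0 ≤ ⌊x * 10 ^ 18⌋ := Int.floor_nonneg.mpr (by positivity)
  rw [roundDown]
  positivity

/-- A lower bound for `exp (-y)`. -/
def expNegLo (y : ℚ) : ℚ :=
  if y ≤ 2048 then
    (fun p => roundDown (p * p))^[12] (roundDown (1 - y / 4096 + (y / 4096) ^ 2 / 2 -
      (y / 4096) ^ 3 / 6 - (y / 4096) ^ 4 * (5 / 96)))
  else 0

/-- An upper bound for `exp (-y)`. -/
def expNegHi (y : ℚ) : ℚ :=
  if y ≤ 2048 then
    (fun p => roundUp (p * p))^[12] (roundUp (1 - y / 4096 + (y / 4096) ^ 2 / 2 -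
      (y / 4096) ^ 3 / 6 + (y / 4096) ^ 4 * (5 / 96)))
  else 1

lemma iterate_roundDown_le (k : ℕ) : ∀ (p : ℚ) (t : ℝ), 0 ≤ p → (p : ℝ) ≤ Real.exp t →
    0 ≤ (fun p => roundDown (p * p))^[k] p ∧
      (((fun p => roundDown (p * p))^[k] p : ℚ) : ℝ) ≤ Real.exp (2 ^ k * t) := by
  induction k with
  | zero => intro p t h0 h; simpa using ⟨h0, h⟩
  | succ k ih =>
    intro p t h0 h
    have h1 : ((roundDown (p * p) : ℚ) : ℝ) ≤ Real.exp (2 * t) := by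
      have h2 : ((roundDown (p * p) : ℚ) : ℝ) ≤ ((p * p : ℚ) : ℝ) := by
        exact_mod_cast roundDown_le _
      have h3 : (0 : ℝ) ≤ p := by exact_mod_cast h0
      rw [two_mul, Real.exp_add]
      push_cast at h2
      exact h2.trans (mul_le_mul h h h3 (Real.exp_pos _).le)
    have := ih _ _ (roundDown_nonneg (mul_nonneg h0 h0)) h1
    rwa [← mul_assoc, ← pow_succ] at this

lemma le_iterate_roundUp (k : ℕ) : ∀ (p : ℚ) (t : ℝ), Real.exp t ≤ (p : ℝ) →
    Real.exp (2 ^ k * t) ≤ (((fun p => roundUp (p * p))^[k] p : ℚ) : ℝ) := by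
  induction k with
  | zero => intro p t h; simpa using h
  | succ k ih =>
    intro p t h
    have h1 : Real.exp (2 * t) ≤ ((roundUp (p * p) : ℚ) : ℝ) := by
      have h2 : ((p * p : ℚ) : ℝ) ≤ ((roundUp (p * p) : ℚ) : ℝ) := by
        exact_mod_cast le_roundUp _
      rw [two_mul, Real.exp_add]
      push_cast at h2
      exact (mul_le_mul h h (Real.exp_pos _).le ((Real.exp_pos _).le.trans h)).trans h2
    have := ih _ _ h1
    rwa [← mul_assoc, ← pow_succ] at this

lemma abs_exp_neg_sub_taylor_le {x : ℝ} (h0 : 0 ≤ x) (h1 : x ≤ 1) :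
    |Real.exp (-x) - (1 - x + x ^ 2 / 2 - x ^ 3 / 6)| ≤ x ^ 4 * (5 / 96) := by
  have h := Real.exp_bound (x := -x) (by rwa [abs_neg, abs_of_nonneg h0]) (n := 4) (by norm_num)
  rw [abs_neg, abs_of_nonneg h0] at h
  convert h using 2
  · simp [Finset.sum_range_succ, Nat.factorial]
    ring
  · norm_num [Nat.factorial]

lemma expNegLo_nonneg_and_le {y : ℚ} (hy : 0 ≤ y) :
    0 ≤ expNegLo y ∧ (expNegLo y : ℝ) ≤ Real.exp (-y) := by
  rw [expNegLo]
  split_ifs with h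
  · set x := y / 4096 with hx
    have hx0 : 0 ≤ x := by positivity
    have hx1 : x ≤ 1 / 2 := by rw [hx]; linarith
    set q : ℚ := 1 - x + x ^ 2 / 2 - x ^ 3 / 6 - x ^ 4 * (5 / 96) with hq
    have hq0 : 0 ≤ q := by
      have h3 : x ^ 3 ≤ x ^ 2 := pow_le_pow_of_le_one hx0 (by linarith) (by norm_num)
      have h4 : x ^ 4 ≤ x ^ 2 := pow_le_pow_of_le_one hx0 (by linarith) (by norm_num)
      nlinarith [sq_nonneg x]
    have hq1 : (q : ℝ) ≤ Real.exp (-(x : ℝ)) := by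
      have hb := (abs_le.mp (abs_exp_neg_sub_taylor_le (x := (x : ℝ)) (by exact_mod_cast hx0)
        (by exact_mod_cast hx1.trans (by norm_num)))).1
      rw [hq]
      push_cast
      linarith
    have hr : ((roundDown q : ℚ) : ℝ) ≤ Real.exp (-(x : ℝ)) :=
      le_trans (by exact_mod_cast roundDown_le q) hq1
    have := iterate_roundDown_le 12 _ _ (roundDown_nonneg hq0) hr
    have e : (2 : ℝ) ^ 12 * -(x : ℝ) = -(y : ℝ) := by
      rw [hx]
      push_cast
      ring
    rwa [e] at this
  · simp [(Real.exp_pos _).le]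

lemma expNegLo_le {y : ℚ} {z : ℝ} (hy : 0 ≤ y) (hz : z ≤ y) : (expNegLo y : ℝ) ≤ Real.exp (-z) :=
  (expNegLo_nonneg_and_le hy).2.trans (Real.exp_le_exp.mpr (by linarith))

lemma le_expNegHi {y : ℚ} {z : ℝ} (hy : 0 ≤ y) (hz : y ≤ z) :
    Real.exp (-z) ≤ (expNegHi y : ℝ) := by
  refine (Real.exp_le_exp.mpr (neg_le_neg hz)).trans ?_
  rw [expNegHi]
  split_ifs with h
  · set x := y / 4096 with hx
    have hx0 : 0 ≤ x := by positivity
    have hx1 : x ≤ 1 := by rw [hx]; linarith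
    set q : ℚ := 1 - x + x ^ 2 / 2 - x ^ 3 / 6 + x ^ 4 * (5 / 96) with hq
    have hq1 : Real.exp (-(x : ℝ)) ≤ (q : ℝ) := by
      have hb := (abs_le.mp (abs_exp_neg_sub_taylor_le (x := (x : ℝ)) (by exact_mod_cast hx0)
        (by exact_mod_cast hx1))).2
      rw [hq]
      push_cast
      linarith
    have hr : Real.exp (-(x : ℝ)) ≤ ((roundUp q : ℚ) : ℝ) :=
      hq1.trans (by exact_mod_cast le_roundUp q)
    have := le_iterate_roundUp 12 _ _ hr
    have e : (2 : ℝ) ^ 12 * -(x : ℝ) = -(y : ℝ) := by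
      rw [hx]
      push_cast
      ring
    rwa [e] at this
  · have : (0 : ℝ) ≤ y := by exact_mod_cast hy
    simpa using this

/-- A lower bound for `π`. -/
def piLo : ℚ := 3.14159265358979

/-- An upper bound for `π`. -/
def piHi : ℚ := 3.1415926535898

lemma piLo_le : (piLo : ℝ) ≤ Real.pi := by
  have := Real.pi_gt_d20
  norm_num [piLo] at this ⊢
  linarith

lemma le_piHi : Real.pi ≤ (piHi : ℝ) := by
  have := Real.pi_lt_d20
  norm_num [piHi] at this ⊢
  linarith

/-- A lower bound for `thetaTail`. -/
def thetaLo (x : ℚ) : ℚ := expNegLo (piHi * x) + expNegLo (piHi * x) ^ 4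

/-- An upper bound for `thetaTail`. -/
def thetaHi (x : ℚ) : ℚ :=
  expNegHi (piLo * x) + expNegHi (piLo * x) ^ 4 + 2 * expNegHi (piLo * x) ^ 9

lemma thetaTail_bounds {x : ℝ} (hx : 1 ≤ x) :
    Real.exp (-(Real.pi * x)) + Real.exp (-(Real.pi * x)) ^ 4 ≤ thetaTail x ∧
      thetaTail x ≤ Real.exp (-(Real.pi * x)) + Real.exp (-(Real.pi * x)) ^ 4 +
        2 * Real.exp (-(Real.pi * x)) ^ 9 := by
  have h := hasSum_thetaTail (x := x) (by linarith)
  set q := Real.exp (-(Real.pi * x)) with hq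
  have hq0 : 0 < q := Real.exp_pos _
  have hqh : q ≤ 1 / 2 := by
    have h1 : 1 ≤ Real.pi * x :=
      one_le_mul_of_one_le_of_one_le (by linarith [Real.pi_gt_three]) hx
    have h2 := Real.add_one_le_exp (Real.pi * x)
    rw [hq, Real.exp_neg, one_div]
    exact inv_anti₀ (by norm_num) (by linarith)
  have hterm : ∀ n : ℕ, Real.exp (-Real.pi * ((n : ℝ) + 1) ^ 2 * x) = q ^ ((n + 1) ^ 2) := by
    intro n
    rw [hq, ← Real.exp_nat_mul]
    push_cast
    ring_nf
  simp_rw [hterm] at h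
  have h2 := (hasSum_nat_add_iff' 2).mpr h
  have e : ∑ i ∈ Finset.range 2, q ^ ((i + 1) ^ 2) = q + q ^ 4 := by
    simp [Finset.sum_range_succ]
  rw [e] at h2
  have hge := h2.nonneg fun n => by positivity
  have hle := hasSum_le (fun n => ?_) h2
    ((hasSum_geometric_of_lt_one (r := (1 / 2 : ℝ)) (by norm_num) (by norm_num)).mul_left (q ^ 9))
  · norm_num at hle
    constructor <;> linarith
  · calc q ^ ((n + 2 + 1) ^ 2) ≤ q ^ (9 + n) :=
          pow_le_pow_of_le_one hq0.le (by linarith) (by nlinarith)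
      _ = q ^ 9 * q ^ n := pow_add _ _ _
      _ ≤ q ^ 9 * (1 / 2) ^ n := by gcongr

lemma thetaLo_le {x : ℚ} (hx : 1 ≤ x) : (thetaLo x : ℝ) ≤ thetaTail x := by
  have hxr : (1 : ℝ) ≤ x := by exact_mod_cast hx
  have hy : 0 ≤ piHi * x := by
    have : (0 : ℚ) ≤ piHi := by norm_num [piHi]
    positivity
  refine le_trans ?_ (thetaTail_bounds hxr).1
  have h0 : (0 : ℝ) ≤ (expNegLo (piHi * x) : ℝ) := by exact_mod_cast (expNegLo_nonneg_and_le hy).1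
  have h1 : (expNegLo (piHi * x) : ℝ) ≤ Real.exp (-(Real.pi * x)) := by
    refine expNegLo_le hy ?_
    push_cast
    exact mul_le_mul_of_nonneg_right le_piHi (by linarith)
  rw [thetaLo]
  push_cast
  gcongr

lemma le_thetaHi {x : ℚ} (hx : 1 ≤ x) : thetaTail x ≤ (thetaHi x : ℝ) := by
  have hxr : (1 : ℝ) ≤ x := by exact_mod_cast hx
  have hy : 0 ≤ piLo * x := by
    have : (0 : ℚ) ≤ piLo := by norm_num [piLo]
    positivity
  refine (thetaTail_bounds hxr).2.trans ?_
  have h1 : Real.exp (-(Real.pi * x)) ≤ (expNegHi (piLo * x) : ℝ) := by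
    refine le_expNegHi hy ?_
    push_cast
    exact mul_le_mul_of_nonneg_right piLo_le (by linarith)
  rw [thetaHi]
  push_cast
  gcongr

/-- An upper bound, on `[r, s]`, for the sampled completed zeta function. -/
def sampleHi (k : ℕ) (r s : ℚ) : ℚ :=
  4 * (thetaHi 1 + ∑ i ∈ Finset.range k, (r ^ (2 * i + 2) * thetaHi (r ^ (4 * (2 * i + 2))) -
    s ^ (2 * i + 1) * thetaLo (s ^ (4 * (2 * i + 1))))) - 2 * thetaLo 1 + (1 - r) / (1 + r)

/-- A lower bound for the sampled completed zeta function. -/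
def sampleLo (k : ℕ) (r : ℚ) : ℚ :=
  4 * (∑ i ∈ Finset.range k, (r ^ (2 * i) * thetaLo (r ^ (4 * (2 * i))) -
    r ^ (2 * i + 1) * thetaHi (r ^ (4 * (2 * i + 1))))) - 2 * thetaHi 1 + (1 - r) / (1 + r)

lemma le_pow_mul_thetaHi {r : ℚ} (hr : 1 ≤ r) (n : ℕ) :
    (r : ℝ) ^ n * thetaTail ((r : ℝ) ^ (4 * n)) ≤ ((r ^ n * thetaHi (r ^ (4 * n)) : ℚ) : ℝ) := by
  have h := le_thetaHi (one_le_pow₀ (n := 4 * n) hr)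
  have hr0 : (0 : ℝ) ≤ r := by exact_mod_cast (zero_le_one.trans hr)
  push_cast at h ⊢
  gcongr

lemma pow_mul_thetaLo_le {r : ℚ} (hr : 1 ≤ r) (n : ℕ) :
    ((r ^ n * thetaLo (r ^ (4 * n)) : ℚ) : ℝ) ≤ (r : ℝ) ^ n * thetaTail ((r : ℝ) ^ (4 * n)) := by
  have h := thetaLo_le (one_le_pow₀ (n := 4 * n) hr)
  have hr0 : (0 : ℝ) ≤ r := by exact_mod_cast (zero_le_one.trans hr)
  push_cast at h ⊢
  gcongr

lemma le_sampleHi (k : ℕ) {r s : ℚ} {x : ℝ} (hr : 1 ≤ r) (hx : 1 < x) (hrx : (r : ℝ) ≤ x)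
    (hxs : x ≤ (s : ℝ)) :
    4 * altTheta x - 2 * thetaTail 1 + (1 - x) / (1 + x) ≤ (sampleHi k r s : ℝ) := by
  have hr1 : (1 : ℝ) ≤ r := by exact_mod_cast hr
  have hs : 1 ≤ s := by exact_mod_cast hr1.trans (hrx.trans hxs)
  have hsum : ∀ k : ℕ, ∑ n ∈ Finset.range (2 * k + 1), (-1) ^ n *
      (x ^ n * thetaTail (x ^ (4 * n))) ≤ ((thetaHi 1 + ∑ i ∈ Finset.range k,
        (r ^ (2 * i + 2) * thetaHi (r ^ (4 * (2 * i + 2))) -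
          s ^ (2 * i + 1) * thetaLo (s ^ (4 * (2 * i + 1)))) : ℚ) : ℝ) := by
    intro k
    induction k with
    | zero => simpa using le_thetaHi le_rfl
    | succ k ih =>
      rw [show 2 * (k + 1) + 1 = 2 * k + 1 + 1 + 1 by ring, Finset.sum_range_succ,
        Finset.sum_range_succ, Finset.sum_range_succ (n := k), ← add_assoc, Rat.cast_add,
        Rat.cast_sub]
      have h1 := (pow_mul_thetaTail_anti hr1 hrx (2 * k + 2)).trans (le_pow_mul_thetaHi hr _)
      have h2 := (pow_mul_thetaLo_le hs (2 * k + 1)).trans (pow_mul_thetaTail_anti hx.le hxs _)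
      rw [Even.neg_one_pow (n := 2 * k + 1 + 1) ⟨k + 1, by ring⟩,
        Odd.neg_one_pow (n := 2 * k + 1) ⟨k, rfl⟩]
      linarith
  have h1 := (altTheta_le_sum_range_odd hx k).trans (hsum k)
  have h2 : (1 - x) / (1 + x) ≤ (1 - r) / (1 + r) := by
    rw [div_le_div_iff₀ (by linarith) (by linarith)]
    nlinarith
  have h3 := thetaLo_le (x := 1) le_rfl
  rw [sampleHi]
  push_cast at h1 h3 ⊢
  linarith

lemma sampleLo_le (k : ℕ) {r : ℚ} (hr : 1 < r) :
    (sampleLo k r : ℝ) ≤ 4 * altTheta r - 2 * thetaTail 1 + (1 - r) / (1 + r) := by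
  have hr1 : (1 : ℝ) < r := by exact_mod_cast hr
  have hsum : ∀ k : ℕ, ((∑ i ∈ Finset.range k, (r ^ (2 * i) * thetaLo (r ^ (4 * (2 * i))) -
      r ^ (2 * i + 1) * thetaHi (r ^ (4 * (2 * i + 1)))) : ℚ) : ℝ) ≤
      ∑ n ∈ Finset.range (2 * k), (-1) ^ n * ((r : ℝ) ^ n * thetaTail ((r : ℝ) ^ (4 * n))) := by
    intro k
    induction k with
    | zero => simp
    | succ k ih =>
      rw [show 2 * (k + 1) = 2 * k + 1 + 1 by ring, Finset.sum_range_succ (n := k),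
        Finset.sum_range_succ (n := 2 * k + 1), Finset.sum_range_succ (n := 2 * k), Rat.cast_add,
        Rat.cast_sub]
      have h1 := pow_mul_thetaLo_le hr.le (2 * k)
      have h2 := le_pow_mul_thetaHi hr.le (2 * k + 1)
      rw [Even.neg_one_pow (n := 2 * k) ⟨k, by ring⟩,
        Odd.neg_one_pow (n := 2 * k + 1) ⟨k, rfl⟩]
      linarith
  have h1 := (hsum k).trans (sum_range_even_le_altTheta hr1 k)
  have h3 := le_thetaHi (x := 1) le_rfl
  rw [sampleLo]
  push_cast at h1 h3 ⊢
  linarith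

/-- An upper bound for `exp (-π / (4 log x))` when `x ≤ s`. -/
def nomeHi (s : ℚ) : ℚ := expNegHi (piLo / (2 * (s - 1 / s)))

lemma exp_le_nomeHi {s : ℚ} {x : ℝ} (hx : 1 < x) (hxs : x ≤ (s : ℝ)) :
    Real.exp (-(Real.pi / (2 * Real.log x) / 2)) ≤ (nomeHi s : ℝ) := by
  have hl : 0 < Real.log x := Real.log_pos hx
  have hs1 : (1 : ℝ) < s := hx.trans_le hxs
  have hlog : Real.log x ≤ ((s : ℝ) - 1 / s) / 2 := by
    have h1 := Real.log_le_log (by linarith) hxs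
    have h2 := Real.self_le_sinh_iff.mpr (Real.log_pos hs1).le
    rw [Real.sinh_log (by linarith)] at h2
    rw [one_div]
    linarith
  have hpi : (0 : ℚ) ≤ piLo := by norm_num [piLo]
  have hs : (0 : ℚ) ≤ s - 1 / s := by
    have : (0 : ℝ) ≤ ((s - 1 / s : ℚ) : ℝ) := by push_cast; linarith
    exact_mod_cast this
  refine le_expNegHi (by positivity) ?_
  push_cast
  rw [div_div]
  have hpi' : (0 : ℝ) ≤ piLo := by exact_mod_cast hpi
  exact div_le_div₀ Real.pi_pos.le piLo_le (by positivity) (by linarith)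

lemma one_sub_inv_le_log {r : ℚ} {x : ℝ} (hr : 0 < r) (hrx : (r : ℝ) ≤ x) :
    ((1 - 1 / r : ℚ) : ℝ) ≤ Real.log x := by
  have hr0 : (0 : ℝ) < r := by exact_mod_cast hr
  have h1 := Real.one_sub_inv_le_log_of_pos hr0
  have h2 := Real.log_le_log hr0 hrx
  push_cast
  rw [one_div]
  linarith

lemma xiLine_neg_of_sampleHi (k : ℕ) {r s : ℚ} {x : ℝ} (hrx : (r : ℝ) ≤ x) (hxs : x ≤ (s : ℝ))
    (h : 1 < r ∧ sampleHi k r s < 0 ∧ nomeHi s < 1 ∧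
      20 * nomeHi s ^ 3 / (1 - nomeHi s ^ 2) + sampleHi k r s * (1 - 1 / r) < 0) :
    xiLine (Real.pi / (2 * Real.log x)) < 0 := by
  obtain ⟨hr, hneg, hp1, hfin⟩ := h
  have hx : 1 < x := lt_of_lt_of_le (by exact_mod_cast hr) hrx
  have hA := le_sampleHi k hr.le hx hrx hxs
  have hE := (abs_le.mp (abs_xiLine_sub_le hx (exp_le_nomeHi hx hxs) (by exact_mod_cast hp1))).2
  have hlog := one_sub_inv_le_log (by linarith) hrx
  have hneg' : (sampleHi k r s : ℝ) < 0 := by exact_mod_cast hneg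
  have hfin' : (20 * (nomeHi s : ℝ) ^ 3 / (1 - (nomeHi s : ℝ) ^ 2) +
      (sampleHi k r s : ℝ) * ((1 - 1 / r : ℚ) : ℝ)) < 0 := by exact_mod_cast hfin
  have h1 := mul_le_mul_of_nonneg_right hA (Real.log_pos hx).le
  have h2 := mul_le_mul_of_nonpos_left hlog hneg'.le
  linarith

lemma xiLine_pos_of_sampleLo (k : ℕ) {r : ℚ}
    (h : 1 < r ∧ 0 < sampleLo k r ∧ nomeHi r < 1 ∧
      20 * nomeHi r ^ 3 / (1 - nomeHi r ^ 2) < sampleLo k r * (1 - 1 / r)) :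
    0 < xiLine (Real.pi / (2 * Real.log r)) := by
  obtain ⟨hr, hpos, hp1, hfin⟩ := h
  have hx : (1 : ℝ) < r := by exact_mod_cast hr
  have hA := sampleLo_le k hr
  have hE := (abs_le.mp (abs_xiLine_sub_le hx (exp_le_nomeHi hx le_rfl)
    (by exact_mod_cast hp1))).1
  have hlog := one_sub_inv_le_log (r := r) (by linarith) le_rfl
  have hpos' : (0 : ℝ) < sampleLo k r := by exact_mod_cast hpos
  have hfin' : 20 * (nomeHi r : ℝ) ^ 3 / (1 - (nomeHi r : ℝ) ^ 2) <
      (sampleLo k r : ℝ) * ((1 - 1 / r : ℚ) : ℝ) := by exact_mod_cast hfin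
  have h1 := mul_le_mul_of_nonneg_right hA (Real.log_pos hx).le
  have h2 := mul_le_mul_of_nonneg_left hlog hpos'.le
  linarith

lemma pi_div_two_mul_log_mem {r a b : ℚ}
    (h : 1 < r ∧ 0 < a ∧ 0 < b ∧ expNegHi (piLo / (2 * a)) < 1 / r ∧
      1 / r < expNegLo (piHi / (2 * b))) :
    Real.pi / (2 * Real.log r) ∈ Set.Ioo (a : ℝ) (b : ℝ) := by
  obtain ⟨hr, ha, hb, h1, h2⟩ := h
  have hr' : (1 : ℝ) < r := by exact_mod_cast hr
  have ha' : (0 : ℝ) < a := by exact_mod_cast ha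
  have hb' : (0 : ℝ) < b := by exact_mod_cast hb
  have hl : 0 < Real.log r := Real.log_pos hr'
  have hinv : ((1 / r : ℚ) : ℝ) = Real.exp (-Real.log r) := by
    rw [Real.exp_neg, Real.exp_log (by linarith)]
    push_cast
    rw [one_div]
  have hlo : (0 : ℚ) ≤ piLo := by norm_num [piLo]
  have hhi : (0 : ℚ) ≤ piHi := by norm_num [piHi]
  have e1 : Real.exp (-(Real.pi / (2 * a))) < Real.exp (-Real.log r) := by
    rw [← hinv]
    refine lt_of_le_of_lt (le_expNegHi (y := piLo / (2 * a)) (by positivity) ?_)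
      (by exact_mod_cast h1)
    push_cast
    have := piLo_le
    gcongr
  have e2 : Real.exp (-Real.log r) < Real.exp (-(Real.pi / (2 * b))) := by
    rw [← hinv]
    refine lt_of_lt_of_le (by exact_mod_cast h2)
      (expNegLo_le (y := piHi / (2 * b)) (by positivity) ?_)
    push_cast
    have := le_piHi
    gcongr
  rw [Real.exp_lt_exp, neg_lt_neg_iff] at e1 e2
  rw [lt_div_iff₀ (by positivity)] at e1
  rw [div_lt_iff₀ (by positivity)] at e2
  constructor
  · rw [lt_div_iff₀ (by positivity)]
    linarith
  · rw [div_lt_iff₀ (by positivity)]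
    linarith

lemma xiLine_neg_of_mem_Icc_sample {x : ℝ} (h0 : (1.13681 : ℝ) ≤ x) (h1 : x ≤ 1.332) :
    xiLine (Real.pi / (2 * Real.log x)) < 0 := by
  have piece : ∀ r s : ℚ, (1 < r ∧ sampleHi 1 r s < 0 ∧ nomeHi s < 1 ∧
      20 * nomeHi s ^ 3 / (1 - nomeHi s ^ 2) + sampleHi 1 r s * (1 - 1 / r) < 0) →
      (r : ℝ) ≤ x → x ≤ (s : ℝ) → xiLine (Real.pi / (2 * Real.log x)) < 0 :=
    fun r s h hr hs => xiLine_neg_of_sampleHi 1 hr hs h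
  have c1 := piece 1.13681 1.1385 (by decide +kernel)
  have c2 := piece 1.1385 1.1405 (by decide +kernel)
  have c3 := piece 1.1405 1.143 (by decide +kernel)
  have c4 := piece 1.143 1.1461 (by decide +kernel)
  have c5 := piece 1.1461 1.1502 (by decide +kernel)
  have c6 := piece 1.1502 1.1559 (by decide +kernel)
  have c7 := piece 1.1559 1.1646 (by decide +kernel)
  have c8 := piece 1.1646 1.18 (by decide +kernel)
  have c9 := piece 1.18 1.2 (by decide +kernel)
  have c10 := piece 1.2 1.22 (by decide +kernel)
  have c11 := piece 1.22 1.27 (by decide +kernel)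
  have c12 := piece 1.27 1.31 (by decide +kernel)
  have c13 := piece 1.31 1.332 (by decide +kernel)
  push_cast at c1 c2 c3 c4 c5 c6 c7 c8 c9 c10 c11 c12 c13
  rcases le_total x 1.1385 with h | h
  · exact c1 (by linarith) (by linarith)
  rcases le_total x 1.1405 with h | h
  · exact c2 (by linarith) (by linarith)
  rcases le_total x 1.143 with h | h
  · exact c3 (by linarith) (by linarith)
  rcases le_total x 1.1461 with h | h
  · exact c4 (by linarith) (by linarith)
  rcases le_total x 1.1502 with h | h
  · exact c5 (by linarith) (by linarith)
  rcases le_total x 1.1559 with h | h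
  · exact c6 (by linarith) (by linarith)
  rcases le_total x 1.1646 with h | h
  · exact c7 (by linarith) (by linarith)
  rcases le_total x 1.18 with h | h
  · exact c8 (by linarith) (by linarith)
  rcases le_total x 1.2 with h | h
  · exact c9 (by linarith) (by linarith)
  rcases le_total x 1.22 with h | h
  · exact c10 (by linarith) (by linarith)
  rcases le_total x 1.27 with h | h
  · exact c11 (by linarith) (by linarith)
  rcases le_total x 1.31 with h | h
  · exact c12 (by linarith) (by linarith)
  · exact c13 (by linarith) (by linarith)

lemma xiLine_neg_of_mem_Icc {t : ℝ} (h0 : 5.5 ≤ t) (h1 : t ≤ 12.25) : xiLine t < 0 := by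
  have ht : 0 < t := by linarith
  have hpi := Real.pi_pos
  have e : Real.pi / (2 * Real.log (Real.exp (Real.pi / (2 * t)))) = t := by
    rw [Real.log_exp]
    field_simp
  rw [← e]
  apply xiLine_neg_of_mem_Icc_sample
  · have h2 : ((1.13681 : ℚ) : ℝ) ∈ Set.Iic (Real.exp (Real.pi / 24.5)) := by
      have h3 := le_expNegHi (y := piLo / 24.5) (z := Real.pi / 24.5) (by decide +kernel) (by
        push_cast
        have := piLo_le
        gcongr)
      have h4 : expNegHi (piLo / 24.5) ≤ 1 / 1.13681 := by decide +kernel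
      have h5 : (expNegHi (piLo / 24.5) : ℝ) ≤ ((1 / 1.13681 : ℚ) : ℝ) := by exact_mod_cast h4
      have h6 := h3.trans h5
      rw [Real.exp_neg] at h6
      push_cast at h6
      rw [one_div] at h6
      rw [Set.mem_Iic]
      push_cast
      exact (inv_le_inv₀ (Real.exp_pos _) (by norm_num)).mp h6
    refine le_trans (by simpa using h2) (Real.exp_le_exp.mpr ?_)
    exact div_le_div_of_nonneg_left hpi.le (by linarith) (by linarith)
  · have h3 := expNegLo_le (y := piHi / 11) (z := Real.pi / 11) (by decide +kernel) (by
        push_cast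
        have := le_piHi
        gcongr)
    have h4 : 1 / 1.332 ≤ expNegLo (piHi / 11) := by decide +kernel
    have h5 : ((1 / 1.332 : ℚ) : ℝ) ≤ (expNegLo (piHi / 11) : ℝ) := by exact_mod_cast h4
    have h6 := h5.trans h3
    rw [Real.exp_neg] at h6
    push_cast at h6
    rw [one_div] at h6
    refine le_trans (Real.exp_le_exp.mpr ?_) ((inv_le_inv₀ (by norm_num) (Real.exp_pos _)).mp h6)
    exact div_le_div_of_nonneg_left hpi.le (by linarith) (by linarith)

lemma exists_xiLine_zero {a b : ℝ} (hab : a ≤ b) (h : xiLine a * xiLine b < 0) :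
    ∃ g ∈ Set.Ioo a b, xiLine g = 0 := by
  rcases mul_neg_iff.mp h with ⟨h1, h2⟩ | ⟨h1, h2⟩
  · exact intermediate_value_Ioo' hab continuous_xiLine.continuousOn ⟨h2, h1⟩
  · exact intermediate_value_Ioo hab continuous_xiLine.continuousOn ⟨h1, h2⟩

lemma exists_first_three_zeros : ∃ g₁ g₂ g₃ : ℝ, xiLine g₁ = 0 ∧ xiLine g₂ = 0 ∧ xiLine g₃ = 0 ∧
    g₁ ∈ Set.Ioo (13.86 : ℝ) 15.05 ∧ g₂ ∈ Set.Ioo (19.6 : ℝ) 21.55 ∧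
      g₃ ∈ Set.Ioo (21.45 : ℝ) 26.6 ∧ g₂ < g₃ := by
  have n1 := xiLine_neg_of_sampleHi 4 (r := 1.12) (s := 1.12) le_rfl le_rfl (by decide +kernel)
  have p2 := xiLine_pos_of_sampleLo 4 (r := 1.1104) (by decide +kernel)
  have p3 := xiLine_pos_of_sampleLo 5 (r := 13 / 12) (by decide +kernel)
  have n4 := xiLine_neg_of_sampleHi 5 (r := 1.0758) (s := 1.0758) le_rfl le_rfl
    (by decide +kernel)
  have p5 := xiLine_pos_of_sampleLo 6 (r := 1.061) (by decide +kernel)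
  have t1 := pi_div_two_mul_log_mem (r := 1.12) (a := 13.86) (b := 13.87) (by decide +kernel)
  have t2 := pi_div_two_mul_log_mem (r := 1.1104) (a := 14) (b := 15.05) (by decide +kernel)
  have t3 := pi_div_two_mul_log_mem (r := 13 / 12) (a := 19.6) (b := 19.7) (by decide +kernel)
  have t4 := pi_div_two_mul_log_mem (r := 1.0758) (a := 21.45) (b := 21.55) (by decide +kernel)
  have t5 := pi_div_two_mul_log_mem (r := 1.061) (a := 26) (b := 26.6) (by decide +kernel)
  norm_num [Set.mem_Ioo] at t1 t2 t3 t4 t5 n1 p2 p3 n4 p5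
  obtain ⟨g₁, ⟨a1, b1⟩, z1⟩ := exists_xiLine_zero (by linarith) (mul_neg_of_neg_of_pos n1 p2)
  obtain ⟨g₂, ⟨a2, b2⟩, z2⟩ := exists_xiLine_zero (by linarith) (mul_neg_of_pos_of_neg p3 n4)
  obtain ⟨g₃, ⟨a3, b3⟩, z3⟩ := exists_xiLine_zero (by linarith) (mul_neg_of_neg_of_pos n4 p5)
  refine ⟨g₁, g₂, g₃, z1, z2, z3, ⟨?_, ?_⟩, ⟨?_, ?_⟩, ⟨?_, ?_⟩, ?_⟩ <;> norm_num <;> linarith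

lemma thetaKer_le_of_exp (v : ℝ) : thetaKer v ≤ 0.0868 * Real.exp (-2.89 * |v|) := by
  have h0 := abs_nonneg v
  have hx : 1 ≤ Real.exp |v| := Real.one_le_exp h0
  have hb := (thetaTail_bounds hx).2
  have h1 : Real.exp (-(Real.pi * Real.exp |v|)) ≤ Real.exp (-Real.pi) * Real.exp (-3.14 * |v|) := by
    rw [← Real.exp_add, Real.exp_le_exp]
    nlinarith [Real.add_one_le_exp |v|, Real.pi_gt_d2]
  have h2 : Real.exp (-Real.pi) ≤ 0.0433 := by
    have h3 := le_expNegHi (y := piLo) (by decide +kernel) piLo_le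
    have h4 : expNegHi piLo ≤ 0.0433 := by decide +kernel
    have h5 : (expNegHi piLo : ℝ) ≤ ((0.0433 : ℚ) : ℝ) := by exact_mod_cast h4
    push_cast at h5
    exact h3.trans h5
  set q := Real.exp (-(Real.pi * Real.exp |v|)) with hq
  have hq0 : 0 < q := Real.exp_pos _
  have hE : Real.exp (-3.14 * |v|) ≤ 1 := by
    rw [Real.exp_le_one_iff]
    linarith
  have hq1 : q ≤ 0.0433 * Real.exp (-3.14 * |v|) :=
    h1.trans (mul_le_mul_of_nonneg_right h2 (Real.exp_pos _).le)
  have hq2 : q ≤ 1 / 20 := by linarith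
  have h4 : q ^ 4 ≤ 0.000125 * q := by
    have : q ^ 3 ≤ (1 / 20) ^ 3 := by gcongr
    nlinarith
  have h9 : q ^ 9 ≤ 0.000125 * q := by
    refine le_trans (pow_le_pow_of_le_one hq0.le (by linarith) (by norm_num)) h4
  have h5 : thetaTail (Real.exp |v|) ≤ 0.0434 * Real.exp (-3.14 * |v|) := by
    refine hb.trans ?_
    nlinarith
  have e : Real.exp (-2.89 * |v|) = Real.exp (|v| / 4) * Real.exp (-3.14 * |v|) := by
    rw [← Real.exp_add]
    ring_nf
  rw [thetaKer, e]
  have := mul_le_mul_of_nonneg_left h5 (Real.exp_pos (|v| / 4)).le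
  nlinarith

lemma integrable_and_integral_exp_neg_abs :
    MeasureTheory.Integrable (fun v : ℝ => 0.0868 * Real.exp (-2.89 * |v|)) ∧
      ∫ v : ℝ, 0.0868 * Real.exp (-2.89 * |v|) = 0.0868 * (2 / 2.89) := by
  have h := integral_comp_abs (f := fun x => Real.exp (-2.89 * x))
  rw [integral_exp_mul_Ioi (by norm_num)] at h
  have h2 : ∫ v : ℝ, Real.exp (-2.89 * |v|) = 2 / 2.89 := by
    rw [h]
    norm_num
  refine ⟨?_, by rw [MeasureTheory.integral_const_mul, h2]⟩
  refine MeasureTheory.Integrable.const_mul ?_ _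
  refine MeasureTheory.Integrable.of_integral_ne_zero ?_
  rw [h2]
  norm_num

lemma norm_completedRiemannZeta₀_half_add_le (t : ℝ) :
    ‖completedRiemannZeta₀ (1 / 2 + I * t)‖ ≤ 0.0301 := by
  have h := fourier_thetaKer t
  rw [Real.fourier_real_eq_integral_exp_smul] at h
  have h1 : ‖(2 : ℂ) * completedRiemannZeta₀ (1 / 2 + I * t)‖ ≤ 0.0868 * (2 / 2.89) := by
    rw [← h, ← integrable_and_integral_exp_neg_abs.2]
    refine MeasureTheory.norm_integral_le_of_norm_le integrable_and_integral_exp_neg_abs.1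
      (MeasureTheory.ae_of_all _ fun v => ?_)
    rw [smul_eq_mul, norm_mul, Complex.norm_exp_ofReal_mul_I, one_mul, Complex.norm_real,
      Real.norm_of_nonneg (thetaKer_nonneg v)]
    exact thetaKer_le_of_exp v
  rw [norm_mul, Complex.norm_ofNat] at h1
  norm_num at h1 ⊢
  linarith

lemma xiLine_neg_of_abs_le {t : ℝ} (ht : |t| ≤ 5.5) : xiLine t < 0 := by
  have h0 := norm_completedRiemannZeta₀_half_add_le t
  have h1 := (le_abs_self _).trans ((Complex.abs_re_le_norm _).trans h0)
  have hpos : 0 < 1 / 4 + t ^ 2 := by positivity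
  have e : (1 / (1 / 2 + I * t) + 1 / (1 - (1 / 2 + I * t)) : ℂ) =
      ((1 / (1 / 4 + t ^ 2) : ℝ) : ℂ) := by
    have h2 := half_add_ne_zero t
    have h3 : (1 - (1 / 2 + I * t) : ℂ) ≠ 0 := sub_ne_zero.mpr (half_add_ne_one t).symm
    have h4 : ((1 / 4 + t ^ 2 : ℝ) : ℂ) = (1 / 2 + I * t) * (1 - (1 / 2 + I * t)) := by
      push_cast
      linear_combination (t : ℂ) ^ 2 * I_sq
    rw [Complex.ofReal_div, Complex.ofReal_one, h4, div_add_div _ _ h2 h3]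
    congr 1
    ring
  have h5 : xiLine t = (completedRiemannZeta₀ (1 / 2 + I * t)).re - 1 / (1 / 4 + t ^ 2) := by
    rw [xiLine, completedRiemannZeta_eq, sub_sub, e, Complex.sub_re, Complex.ofReal_re]
  have h6 : (0.032 : ℝ) ≤ 1 / (1 / 4 + t ^ 2) := by
    have := sq_le_sq' (by linarith [(abs_le.mp ht).1]) (abs_le.mp ht).2
    rw [le_div_iff₀ hpos]
    norm_num at this ⊢
    linarith
  rw [h5]
  norm_num at h1 h6 ⊢
  linarith

lemma lt_of_xiLine_eq_zero {t : ℝ} (ht : 0 ≤ t) (h : xiLine t = 0) : 12.25 < t := by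
  by_contra! hle
  rcases le_total t 5.5 with h1 | h1
  · exact (xiLine_neg_of_abs_le (by rwa [abs_of_nonneg ht])).ne h
  · exact (xiLine_neg_of_mem_Icc h1 hle).ne h

lemma firstZeroOrdinate_nonneg : 0 ≤ firstZeroOrdinate :=
  Real.sInf_nonneg fun _ hy => hy.1.le

lemma card_zeros_le_of_jensen {c : ℂ} {r R M : ℝ} {f : ℂ → ℂ} (hr : 0 < r) (hrR : r < R)
    (hM : 1 ≤ M) (hf : AnalyticOnNhd ℂ f (Metric.closedBall c R)) (hfc : f c ≠ 0)
    (hb : ∀ z ∈ Metric.sphere c R, ‖f z‖ ≤ M) (F : Finset ℂ)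
    (hF : ∀ z ∈ F, z ∈ Metric.closedBall c r ∧ f z = 0) :
    (F.card : ℝ) ≤ Real.log (M / ‖f c‖) / Real.log (R / r) := by
  have hR : |R| = R := abs_of_pos (hr.trans hrR)
  have hr' : |r| = r := abs_of_pos hr
  have key := AnalyticOnNhd.sum_divisor_le (c := c) (r := r) (R := R) (by rwa [hr'])
    (by rwa [hr', hR]) hM (by rwa [hR]) hfc (by rwa [hR])
  refine le_trans ?_ key
  rw [hr']
  have hsub : Metric.closedBall c r ⊆ Metric.closedBall c R :=
    Metric.closedBall_subset_closedBall hrR.le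
  have hfr := hf.mono hsub
  set D := MeromorphicOn.divisor f (Metric.closedBall c r) with hD
  have hfin : D.support.Finite := D.finiteSupport (isCompact_closedBall c r)
  have hnn : 0 ≤ D := MeromorphicOn.AnalyticOnNhd.divisor_nonneg hfr
  have hone : ∀ z ∈ F, 1 ≤ D z := by
    intro z hz
    obtain ⟨hzr, hz0⟩ := hF z hz
    rw [hD, MeromorphicOn.AnalyticOnNhd.divisor_apply hfr hzr]
    have htop : analyticOrderAt f z ≠ ⊤ := by
      intro h
      rw [analyticOrderAt_eq_top] at h
      exact hfc (hf.eqOn_zero_of_preconnected_of_eventuallyEq_zero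
        (convex_closedBall c R).isPreconnected (hsub hzr) h
        (Metric.mem_closedBall_self (hr.trans hrR).le))
    have hne : analyticOrderAt f z ≠ 0 := by
      rw [(hfr z hzr).analyticOrderAt_ne_zero]
      exact hz0
    rw [← Nat.cast_analyticOrderNatAt htop] at hne ⊢
    have : analyticOrderNatAt f z ≠ 0 := by exact_mod_cast hne
    rw [ENat.map_natCast, WithTop.untop₀_coe]
    exact_mod_cast Nat.one_le_iff_ne_zero.mpr this
  have hsubF : F ⊆ hfin.toFinset := by
    intro z hz
    rw [Set.Finite.mem_toFinset, Function.mem_support]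
    have := hone z hz
    omega
  have h1 : ∑ᶠ u, D u = ∑ u ∈ hfin.toFinset, D u :=
    finsum_eq_sum_of_support_subset _ (by simp)
  have h2 : (F.card : ℤ) ≤ ∑ᶠ u, D u := by
    rw [h1]
    calc (F.card : ℤ) = ∑ _z ∈ F, (1 : ℤ) := by simp
      _ ≤ ∑ z ∈ F, D z := Finset.sum_le_sum hone
      _ ≤ _ := Finset.sum_le_sum_of_subset_of_nonneg hsubF fun z _ _ => hnn z
  exact_mod_cast h2

lemma norm_riemannZeta_two_add_ge (T : ℝ) : 0.35 ≤ ‖riemannZeta (2 + I * T)‖ := by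
  have hre : (2 + I * T : ℂ).re = 2 := by simp
  have hz := zeta_eq_tsum_one_div_nat_add_one_cpow (s := 2 + I * T) (by rw [hre]; norm_num)
  have hn : ∀ n : ℕ, ‖1 / ((n : ℂ) + 1) ^ (2 + I * T : ℂ)‖ = 1 / ((n : ℝ) + 1) ^ 2 := by
    intro n
    have := Complex.norm_natCast_cpow_of_pos (n := n + 1) (Nat.succ_pos n) (2 + I * T)
    push_cast at this
    rw [norm_div, this, hre, norm_one]
    norm_num
  have h2 := (hasSum_nat_add_iff' 2).mpr hasSum_zeta_two
  have h3 : HasSum (fun n : ℕ => 1 / (((n + 1 : ℕ) : ℝ) + 1) ^ 2) (Real.pi ^ 2 / 6 - 1) := by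
    have h0 : ∑ i ∈ Finset.range 2, 1 / (i : ℝ) ^ 2 = 1 := by simp [Finset.sum_range_succ]
    rw [h0] at h2
    have h1 : (fun n : ℕ => 1 / (((n + 1 : ℕ) : ℝ) + 1) ^ 2) =
        fun n : ℕ => 1 / ((n + 2 : ℕ) : ℝ) ^ 2 := by
      ext n
      push_cast
      rw [add_assoc, one_add_one_eq_two]
    rw [h1]
    exact h2
  have hs1 : Summable fun n : ℕ => 1 / ((n : ℝ) + 1) ^ 2 := by
    rw [← summable_nat_add_iff 1]
    exact h3.summable
  have hs : Summable fun n : ℕ => 1 / ((n : ℂ) + 1) ^ (2 + I * T : ℂ) :=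
    Summable.of_norm (by simpa only [hn] using hs1)
  rw [hs.tsum_eq_zero_add] at hz
  have h4 : ‖∑' n : ℕ, 1 / (((n + 1 : ℕ) : ℂ) + 1) ^ (2 + I * T : ℂ)‖ ≤ Real.pi ^ 2 / 6 - 1 :=
    tsum_of_norm_bounded h3 fun n => (hn (n + 1)).le
  have h5 : (1 : ℂ) / (((0 : ℕ) : ℂ) + 1) ^ (2 + I * T : ℂ) = 1 := by simp
  rw [h5] at hz
  have h6 : (1 : ℝ) ≤ ‖riemannZeta (2 + I * T)‖ +
      ‖∑' n : ℕ, 1 / (((n + 1 : ℕ) : ℂ) + 1) ^ (2 + I * T : ℂ)‖ := by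
    rw [hz]
    have := norm_sub_le (1 + ∑' n : ℕ, 1 / (((n + 1 : ℕ) : ℂ) + 1) ^ (2 + I * T : ℂ))
      (∑' n : ℕ, 1 / (((n + 1 : ℕ) : ℂ) + 1) ^ (2 + I * T : ℂ))
    rwa [add_sub_cancel_right, norm_one] at this
  have h7 : Real.pi ^ 2 ≤ 9.9 := by nlinarith [Real.pi_lt_d4, Real.pi_pos]
  norm_num at h7 ⊢
  linarith

lemma card_zeros_unit_interval_le {n : ℤ} (hn : 12 ≤ |(n : ℝ)|) (F : Finset ℝ)
    (hF : ∀ t ∈ F, xiLine t = 0 ∧ (n : ℝ) ≤ t ∧ t ≤ n + 1) :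
    (F.card : ℝ) ≤ 108 * Real.sqrt |(n : ℝ)| := by
  set T : ℝ := n + 1 / 2 with hT
  set c : ℂ := 2 + I * T with hc
  have hTn : |T| ≤ |(n : ℝ)| + 1 / 2 := (abs_add_le _ _).trans (by norm_num)
  have hTn' : |(n : ℝ)| ≤ |T| + 1 / 2 := by
    have h := abs_add_le T (-(1 / 2))
    rw [show T + -(1 / 2) = n by rw [hT]; ring] at h
    exact h.trans (by norm_num)
  set e : ℝ ↪ ℂ := ⟨fun t : ℝ => (1 / 2 + I * t : ℂ), fun a b h => by
    have := congrArg im h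
    simpa using this⟩ with he
  have hball : ∀ z ∈ Metric.closedBall c 1.8, 0.2 ≤ z.re ∧ 1 ≤ |z.im| ∧ ‖z‖ ≤ |T| + 4 := by
    intro z hz
    rw [Metric.mem_closedBall, dist_eq_norm] at hz
    have h1 := (Complex.abs_re_le_norm (z - c)).trans hz
    have h2 := (Complex.abs_im_le_norm (z - c)).trans hz
    have e1 : (z - c).re = z.re - 2 := by simp [hc]
    have e2 : (z - c).im = z.im - T := by simp [hc]
    rw [e1, abs_le] at h1
    rw [e2] at h2
    refine ⟨by linarith [h1.1], ?_, ?_⟩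
    · have := abs_sub_abs_le_abs_sub T z.im
      rw [abs_sub_comm] at this
      norm_num at h2
      linarith
    · have h3 : ‖c‖ ≤ 2 + |T| := by
        rw [hc]
        refine (norm_add_le _ _).trans ?_
        simp
      have h4 := norm_add_le (z - c) c
      rw [sub_add_cancel] at h4
      norm_num at hz
      linarith
  have hne1 : ∀ z ∈ Metric.closedBall c 1.8, z ≠ 1 := by
    intro z hz h
    have := (hball z hz).2.1
    rw [h] at this
    norm_num at this
  have han : AnalyticOnNhd ℂ riemannZeta (Metric.closedBall c 1.8) := by
    have : DifferentiableOn ℂ riemannZeta {1}ᶜ := fun z hz =>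
      (differentiableAt_riemannZeta hz).differentiableWithinAt
    exact (this.analyticOnNhd isOpen_compl_singleton).mono fun z hz => hne1 z hz
  have hbound : ∀ z ∈ Metric.sphere c 1.8, ‖riemannZeta z‖ ≤ 6 * (|T| + 4) := by
    intro z hz
    have hz' := Metric.sphere_subset_closedBall hz
    obtain ⟨h1, h2, h3⟩ := hball z hz'
    have h4 : 1 ≤ ‖z - 1‖ := by
      refine h2.trans ?_
      have := Complex.abs_im_le_norm (z - 1)
      simpa using this
    have h5 := norm_riemannZeta_le (s := z) (by linarith) (hne1 z hz')
    have h6 : ‖z‖ / ‖z - 1‖ ≤ ‖z‖ := div_le_self (norm_nonneg _) h4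
    have h7 : ‖z‖ / z.re ≤ ‖z‖ / 0.2 := by gcongr
    norm_num at h7
    linarith
  have hzc := norm_riemannZeta_two_add_ge T
  have hpos : 0 < ‖riemannZeta c‖ := lt_of_lt_of_le (by norm_num) hzc
  have key := card_zeros_le_of_jensen (c := c) (r := 1.6) (R := 1.8) (M := 6 * (|T| + 4))
    (by norm_num) (by norm_num) (by linarith [abs_nonneg T]) han (norm_pos_iff.mp hpos) hbound
    (F.map e) (by
      intro z hz
      obtain ⟨t, ht, rfl⟩ := Finset.mem_map.mp hz
      obtain ⟨h0, h1, h2⟩ := hF t ht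
      refine ⟨?_, (riemannZeta_half_add_eq_zero_iff t).mpr h0⟩
      rw [Metric.mem_closedBall, dist_eq_norm, Complex.norm_eq_sqrt_sq_add_sq]
      refine Real.sqrt_le_iff.mpr ⟨by norm_num, ?_⟩
      have e1 : (e t - c).re = -(3 / 2) := by
        simp [he, hc]
        norm_num
      have e2 : (e t - c).im = t - T := by simp [he, hc]
      rw [e1, e2]
      have h3 : |t - T| ≤ 1 / 2 := by rw [abs_le]; constructor <;> linarith
      have h4 := sq_le_sq' (by linarith [(abs_le.mp h3).1]) (abs_le.mp h3).2
      norm_num at h4 ⊢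
      linarith)
  rw [Finset.card_map] at key
  refine key.trans ?_
  set N := |(n : ℝ)| with hN
  have hMdiv : 6 * (|T| + 4) / ‖riemannZeta c‖ ≤ 36 * N := by
    rw [div_le_iff₀ hpos]
    nlinarith [abs_nonneg T]
  have hlog : Real.log (6 * (|T| + 4) / ‖riemannZeta c‖) ≤ 12 * Real.sqrt N := by
    have h1 : Real.log (6 * (|T| + 4) / ‖riemannZeta c‖) ≤ Real.log (36 * N) :=
      Real.log_le_log (by positivity) hMdiv
    have h2 : Real.log (36 * N) = 2 * Real.log (Real.sqrt (36 * N)) := by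
      rw [Real.log_sqrt (by positivity)]
      ring
    have h3 : Real.log (Real.sqrt (36 * N)) ≤ Real.sqrt (36 * N) :=
      Real.log_le_self (Real.sqrt_nonneg _)
    have h4 : Real.sqrt (36 * N) = 6 * Real.sqrt N := by
      rw [Real.sqrt_mul (by norm_num), show (36 : ℝ) = 6 ^ 2 by norm_num,
        Real.sqrt_sq (by norm_num)]
    linarith
  have hlog2 : 1 / 9 ≤ Real.log (1.8 / 1.6) := by
    have := Real.one_sub_inv_le_log_of_pos (x := 1.8 / 1.6) (by norm_num)
    norm_num at this ⊢
    exact this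
  rw [div_le_iff₀ (by linarith)]
  nlinarith [Real.sqrt_nonneg N]

lemma twelve_le_abs_floor {t : ℝ} (h : xiLine t = 0) : 12 ≤ |((⌊t⌋ : ℤ) : ℝ)| := by
  rcases le_total 0 t with ht | ht
  · have h1 := lt_of_xiLine_eq_zero ht h
    have h2 : (12 : ℤ) ≤ ⌊t⌋ := Int.le_floor.mpr (by norm_num; linarith)
    have h3 : (12 : ℝ) ≤ (⌊t⌋ : ℤ) := by exact_mod_cast h2
    exact h3.trans (le_abs_self _)
  · have h1 := lt_of_xiLine_eq_zero (t := -t) (by linarith) (by rwa [xiLine_neg])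
    have h2 := Int.floor_le t
    exact le_trans (by linarith) (neg_le_abs _)

lemma sqrt_div_sq_eq_rpow {x : ℝ} (hx : 0 < x) : Real.sqrt x / x ^ 2 = x ^ (-(3 / 2) : ℝ) := by
  rw [Real.sqrt_eq_rpow, ← Real.rpow_natCast x 2, ← Real.rpow_sub hx]
  norm_num

lemma summable_one_div_one_add_sq_zeros :
    Summable fun t : {t : ℝ // xiLine t = 0} => 1 / (1 + (t : ℝ) ^ 2) := by
  have hsum : Summable fun n : ℤ => 324 * |(n : ℝ)| ^ (-(3 / 2) : ℝ) :=
    (Real.summable_abs_int_rpow (by norm_num)).mul_left 324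
  refine summable_of_sum_le (c := ∑' n : ℤ, 324 * |(n : ℝ)| ^ (-(3 / 2) : ℝ))
    (fun t => by positivity) fun u => ?_
  rw [← Finset.sum_fiberwise_of_maps_to (t := u.image fun t : {t : ℝ // xiLine t = 0} => ⌊(t : ℝ)⌋)
    (g := fun t : {t : ℝ // xiLine t = 0} => ⌊(t : ℝ)⌋) fun t ht => Finset.mem_image_of_mem _ ht]
  refine le_trans (Finset.sum_le_sum fun n hn => ?_)
    (hsum.sum_le_tsum _ fun n _ => by positivity)
  obtain ⟨t₀, -, rfl⟩ := Finset.mem_image.mp hn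
  set n := ⌊(t₀ : ℝ)⌋
  have hn12 : 12 ≤ |(n : ℝ)| := twelve_le_abs_floor t₀.2
  set V := u.filter fun t : {t : ℝ // xiLine t = 0} => ⌊(t : ℝ)⌋ = n with hV
  have hfl : ∀ t ∈ V, (n : ℝ) ≤ t ∧ (t : ℝ) ≤ n + 1 := by
    intro t ht
    have h := (Finset.mem_filter.mp ht).2
    rw [← h]
    exact ⟨Int.floor_le _, (Int.lt_floor_add_one _).le⟩
  have hcard := card_zeros_unit_interval_le hn12 (V.map (Function.Embedding.subtype _)) (by
    intro t ht
    obtain ⟨s, hs, rfl⟩ := Finset.mem_map.mp ht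
    exact ⟨s.2, hfl s hs⟩)
  rw [Finset.card_map] at hcard
  have hterm : ∀ t ∈ V, 1 / (1 + (t : ℝ) ^ 2) ≤ 3 / |(n : ℝ)| ^ 2 := by
    intro t ht
    obtain ⟨h1, h2⟩ := hfl t ht
    rw [sq_abs, div_le_div_iff₀ (by positivity) (by rw [← sq_abs]; positivity)]
    nlinarith [sq_nonneg ((t : ℝ) + (t - n)), sq_nonneg ((t : ℝ) - n)]
  calc ∑ t ∈ V, 1 / (1 + (t : ℝ) ^ 2) ≤ V.card • (3 / |(n : ℝ)| ^ 2) :=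
        Finset.sum_le_card_nsmul _ _ _ hterm
    _ = V.card * (3 / |(n : ℝ)| ^ 2) := nsmul_eq_mul _ _
    _ ≤ 108 * Real.sqrt |(n : ℝ)| * (3 / |(n : ℝ)| ^ 2) := by gcongr
    _ = 324 * (Real.sqrt |(n : ℝ)| / |(n : ℝ)| ^ 2) := by ring
    _ = 324 * |(n : ℝ)| ^ (-(3 / 2) : ℝ) := by rw [sqrt_div_sq_eq_rpow (by linarith)]

lemma one_div_sub_sq_le {a t δ : ℝ} (hδ : 0 < δ) (h : δ ≤ |t - a|) :
    1 / (t - a) ^ 2 ≤ (2 + (1 + 2 * a ^ 2) / δ ^ 2) * (1 / (1 + t ^ 2)) := by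
  have h1 : δ ^ 2 ≤ (t - a) ^ 2 := by
    rw [← sq_abs (t - a)]
    gcongr
  have h2 : 0 < (t - a) ^ 2 := lt_of_lt_of_le (by positivity) h1
  have h3 : 1 + 2 * a ^ 2 ≤ (1 + 2 * a ^ 2) / δ ^ 2 * (t - a) ^ 2 := by
    rw [div_mul_eq_mul_div, le_div_iff₀ (by positivity)]
    gcongr
  rw [mul_one_div, div_le_div_iff₀ h2 (by positivity)]
  nlinarith [sq_nonneg (t - a - a)]

lemma IsSimpleZeroZ.exists_isolating {a : ℝ} (ha : IsSimpleZeroZ a) :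
    ∃ δ > 0, ∀ t, HardyZ t = 0 → t ≠ a → δ ≤ |t - a| := by
  have h := (differentiableAt_of_deriv_ne_zero ha.2).hasDerivAt.eventually_ne (c := 0) ha.2
  rw [eventually_nhdsWithin_iff, Metric.eventually_nhds_iff] at h
  obtain ⟨δ, hδ, h⟩ := h
  refine ⟨δ, hδ, fun t ht hta => ?_⟩
  by_contra! hlt
  exact h (by rwa [Real.dist_eq]) hta ht

lemma IsSimpleZeroZ.summable_one_div_sub_sq {a b : ℝ} (ha : IsSimpleZeroZ a)
    (hb : IsSimpleZeroZ b) :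
    Summable fun t : {t : ℝ // HardyZ t = 0 ∧ t ≠ a ∧ t ≠ b} =>
      (1 / ((t : ℝ) - a) ^ 2 + 1 / ((t : ℝ) - b) ^ 2) := by
  let e : {t : ℝ // HardyZ t = 0 ∧ t ≠ a ∧ t ≠ b} → {t : ℝ // xiLine t = 0} :=
    fun t => ⟨t, (HardyZ_eq_zero_iff t).mp t.2.1⟩
  have he : Function.Injective e := fun s t h => by
    simpa [e, Subtype.ext_iff] using h
  have hs := summable_one_div_one_add_sq_zeros.comp_injective he
  obtain ⟨δ, hδ, h⟩ := ha.exists_isolating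
  obtain ⟨ε, hε, h'⟩ := hb.exists_isolating
  refine Summable.add (.of_nonneg_of_le (fun t => by positivity) (fun t => ?_)
    (hs.mul_left (2 + (1 + 2 * a ^ 2) / δ ^ 2)))
    (.of_nonneg_of_le (fun t => by positivity) (fun t => ?_)
    (hs.mul_left (2 + (1 + 2 * b ^ 2) / ε ^ 2)))
  · exact one_div_sub_sq_le hδ (h t t.2.1 t.2.2.1)
  · exact one_div_sub_sq_le hε (h' t t.2.1 t.2.2.2)

lemma IsSimpleZeroZ.sum_le_tsum {a b : ℝ} (ha : IsSimpleZeroZ a) (hb : IsSimpleZeroZ b)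
    (F : Finset ℝ) (hF : ∀ t ∈ F, xiLine t = 0 ∧ t ≠ a ∧ t ≠ b) :
    ∑ t ∈ F, (1 / (t - a) ^ 2 + 1 / (t - b) ^ 2) ≤
      ∑' t : {t : ℝ // HardyZ t = 0 ∧ t ≠ a ∧ t ≠ b},
        (1 / ((t : ℝ) - a) ^ 2 + 1 / ((t : ℝ) - b) ^ 2) := by
  have hF' : ∀ t ∈ F, HardyZ t = 0 ∧ t ≠ a ∧ t ≠ b := fun t ht =>
    ⟨(HardyZ_eq_zero_iff t).mpr (hF t ht).1, (hF t ht).2⟩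
  have h := (ha.summable_one_div_sub_sq hb).sum_le_tsum
    (F.subtype fun t => HardyZ t = 0 ∧ t ≠ a ∧ t ≠ b) fun t _ => by positivity
  rwa [Finset.sum_subtype_of_mem (fun t : ℝ => 1 / (t - a) ^ 2 + 1 / (t - b) ^ 2) hF'] at h

/-- The contribution `1 / (g - x)² + 1 / (-g - x)²` of a pair of opposite zeros `±g`. -/
noncomputable def symmInvSq (g x : ℝ) : ℝ := 1 / (g - x) ^ 2 + 1 / (-g - x) ^ 2

/-- The contribution of the zeros `-a` and `-b`. -/
noncomputable def reflInvSq (a b : ℝ) : ℝ :=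
  1 / 4 * (1 / a ^ 2) + 1 / 4 * (1 / b ^ 2) + 2 * (1 / (a + b) ^ 2)

lemma symmInvSq_nonneg (g x : ℝ) : 0 ≤ symmInvSq g x := by
  unfold symmInvSq
  positivity

lemma symmInvSq_eq {g x : ℝ} (hx : 0 < x) (hg : 0 < g) (hne : g ≠ x) :
    symmInvSq g x = 2 * (g ^ 2 + x ^ 2) / (g ^ 2 - x ^ 2) ^ 2 := by
  have h1 : g - x ≠ 0 := sub_ne_zero.mpr hne
  have h2 : g + x ≠ 0 := by positivity
  have h3 : g ^ 2 - x ^ 2 = (g - x) * (g + x) := by ring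
  have h4 : (-g - x) ^ 2 = (g + x) ^ 2 := by ring
  rw [symmInvSq, h3, h4]
  field_simp
  ring

lemma sq_sub_sq_pos {g x : ℝ} (hx : 0 < x) (hg : 0 < g) (hne : g ≠ x) :
    0 < (g ^ 2 - x ^ 2) ^ 2 := by
  have h : g ^ 2 - x ^ 2 ≠ 0 := by
    rw [sq_sub_sq]
    exact mul_ne_zero (by positivity) (sub_ne_zero.mpr hne)
  positivity

lemma four_le_symmInvSq {g x : ℝ} (hx : 0 < x) (h1 : 0.4683 * x ≤ g) (h2 : g ≤ 1.51 * x)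
    (hne : g ≠ x) : 4 * (1 / x ^ 2) ≤ symmInvSq g x := by
  have hg : 0 < g := lt_of_lt_of_le (by positivity) h1
  rw [symmInvSq_eq hx hg hne, mul_one_div,
    div_le_div_iff₀ (by positivity) (sq_sub_sq_pos hx hg hne)]
  have h3 : 0.2193 * x ^ 2 ≤ g ^ 2 := by nlinarith
  have h4 : g ^ 2 ≤ 2.2801 * x ^ 2 := by nlinarith
  nlinarith [mul_nonneg (sub_nonneg.mpr h3) (sub_nonneg.mpr h4),
    mul_nonneg (sq_nonneg x) (sub_nonneg.mpr h3)]

lemma two_le_symmInvSq {g x : ℝ} (hx : 0 < x) (hg : 0 < g) (h2 : g ≤ 1.73 * x)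
    (hne : g ≠ x) : 2 * (1 / x ^ 2) ≤ symmInvSq g x := by
  rw [symmInvSq_eq hx hg hne, mul_one_div,
    div_le_div_iff₀ (by positivity) (sq_sub_sq_pos hx hg hne)]
  have h4 : g ^ 2 ≤ 3 * x ^ 2 := by nlinarith
  nlinarith [mul_nonneg (sq_nonneg g) (sub_nonneg.mpr h4)]

lemma one_div_sq_le_one_div_sq {u c : ℝ} (hu : u ≠ 0) (h : |u| ≤ c) :
    1 / c ^ 2 ≤ 1 / u ^ 2 := by
  have h1 : 0 < u ^ 2 := by positivity
  have h2 : u ^ 2 ≤ c ^ 2 := sq_le_sq.mpr (h.trans (le_abs_self c))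
  gcongr

lemma le_symmInvSq {g x c d : ℝ} (hne : g ≠ x) (hg : 0 < g) (hx : 0 < x) (h1 : |g - x| ≤ c)
    (h2 : g + x ≤ d) : 1 / c ^ 2 + 1 / d ^ 2 ≤ symmInvSq g x := by
  refine add_le_add (one_div_sq_le_one_div_sq (sub_ne_zero.mpr hne) h1)
    (one_div_sq_le_one_div_sq (by linarith) ?_)
  rw [abs_of_neg (by linarith)]
  linarith

lemma IsSimpleZeroZ.symmInvSq_add_le_tsum {a b g : ℝ} (ha : IsSimpleZeroZ a)
    (hb : IsSimpleZeroZ b) (ha0 : 0 < a) (hb0 : 0 < b) (hab : a ≠ b) (hg : xiLine g = 0)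
    (hg0 : 0 < g) (hga : g ≠ a) (hgb : g ≠ b) :
    symmInvSq g a + symmInvSq g b + reflInvSq a b ≤
      ∑' t : {t : ℝ // HardyZ t = 0 ∧ t ≠ a ∧ t ≠ b},
        (1 / ((t : ℝ) - a) ^ 2 + 1 / ((t : ℝ) - b) ^ 2) := by
  have hxa := (HardyZ_eq_zero_iff a).mp ha.1
  have hxb := (HardyZ_eq_zero_iff b).mp hb.1
  refine le_trans (le_of_eq ?_) (ha.sum_le_tsum hb {g, -g, -a, -b} ?_)
  · have h1 : g ∉ ({-g, -a, -b} : Finset ℝ) := by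
      simp only [Finset.mem_insert, Finset.mem_singleton, not_or]
      refine ⟨?_, ?_, ?_⟩ <;> linarith
    have h2 : -g ∉ ({-a, -b} : Finset ℝ) := by simp [hga, hgb]
    have h3 : -a ∉ ({-b} : Finset ℝ) := by simp [hab]
    rw [Finset.sum_insert h1, Finset.sum_insert h2, Finset.sum_insert h3, Finset.sum_singleton,
      show (-b - a) = -(a + b) by ring, show (-a - b) = -(a + b) by ring, symmInvSq, symmInvSq,
      reflInvSq]
    field_simp
    ring
  · simp only [Finset.mem_insert, Finset.mem_singleton, forall_eq_or_imp, forall_eq, xiLine_neg]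
    refine ⟨⟨hg, hga, hgb⟩, ⟨hg, ?_, ?_⟩, ⟨hxa, ?_, ?_⟩, hxb, ?_, ?_⟩ <;> linarith

lemma IsSimpleZeroZ.symmInvSq_add_add_le_tsum {a b g h : ℝ} (ha : IsSimpleZeroZ a)
    (hb : IsSimpleZeroZ b) (ha0 : 0 < a) (hb0 : 0 < b) (hab : a ≠ b) (hg : xiLine g = 0)
    (hg0 : 0 < g) (hga : g ≠ a) (hgb : g ≠ b) (hh : xiLine h = 0) (hh0 : 0 < h) (hha : h ≠ a)
    (hhb : h ≠ b) (hgh : g ≠ h) :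
    symmInvSq g a + symmInvSq g b + (symmInvSq h a + symmInvSq h b) + reflInvSq a b ≤
      ∑' t : {t : ℝ // HardyZ t = 0 ∧ t ≠ a ∧ t ≠ b},
        (1 / ((t : ℝ) - a) ^ 2 + 1 / ((t : ℝ) - b) ^ 2) := by
  have hxa := (HardyZ_eq_zero_iff a).mp ha.1
  have hxb := (HardyZ_eq_zero_iff b).mp hb.1
  refine le_trans (le_of_eq ?_) (ha.sum_le_tsum hb {g, h, -g, -h, -a, -b} ?_)
  · have h1 : g ∉ ({h, -g, -h, -a, -b} : Finset ℝ) := by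
      simp only [Finset.mem_insert, Finset.mem_singleton, not_or]
      refine ⟨hgh, ?_, ?_, ?_, ?_⟩ <;> linarith
    have h2 : h ∉ ({-g, -h, -a, -b} : Finset ℝ) := by
      simp only [Finset.mem_insert, Finset.mem_singleton, not_or]
      refine ⟨?_, ?_, ?_, ?_⟩ <;> linarith
    have h3 : -g ∉ ({-h, -a, -b} : Finset ℝ) := by simp [hga, hgb, hgh]
    have h4 : -h ∉ ({-a, -b} : Finset ℝ) := by simp [hha, hhb]
    have h5 : -a ∉ ({-b} : Finset ℝ) := by simp [hab]
    rw [Finset.sum_insert h1, Finset.sum_insert h2, Finset.sum_insert h3, Finset.sum_insert h4,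
      Finset.sum_insert h5, Finset.sum_singleton,
      show (-b - a) = -(a + b) by ring, show (-a - b) = -(a + b) by ring, symmInvSq, symmInvSq,
      symmInvSq, symmInvSq, reflInvSq]
    ring_nf
  · simp only [Finset.mem_insert, Finset.mem_singleton, forall_eq_or_imp, forall_eq, xiLine_neg]
    refine ⟨⟨hg, hga, hgb⟩, ⟨hh, hha, hhb⟩, ⟨hg, ?_, ?_⟩, ⟨hh, ?_, ?_⟩, ⟨hxa, ?_, ?_⟩,
      hxb, ?_, ?_⟩ <;> linarith

lemma lt_of_first_and_second_zero {a b g S : ℝ} (ha : a ∈ Set.Ioo (13.86 : ℝ) 15.05)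
    (hb : b ∈ Set.Ioo (19.6 : ℝ) 21.55) (hg : g ∈ Set.Ioo (21.45 : ℝ) 26.6) (hbg : b < g)
    (hS : symmInvSq g a + symmInvSq g b + reflInvSq a b ≤ S) :
    4 * (1 / a ^ 2 + 1 / b ^ 2) < S := by
  obtain ⟨ha1, ha2⟩ := ha
  obtain ⟨hb1, hb2⟩ := hb
  obtain ⟨hg1, hg2⟩ := hg
  have bound : ∀ a₀ a₁ b₀ b₁ : ℝ, 13 ≤ a₀ → a₀ ≤ a → a ≤ a₁ → 19 ≤ b₀ → b₀ ≤ b → b ≤ b₁ →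
      1 / (26.6 - a₀) ^ 2 + 1 / (26.6 + a₁) ^ 2 + (1 / (26.6 - b₀) ^ 2 + 1 / (26.6 + b₁) ^ 2)
        + 2 * (1 / (a₁ + b₁) ^ 2) - 15 / 4 * (1 / a₀ ^ 2) - 15 / 4 * (1 / b₀ ^ 2)
        ≤ S - 4 * (1 / a ^ 2 + 1 / b ^ 2) := by
    intro a₀ a₁ b₀ b₁ h1 h2 h3 h4 h5 h6
    have e1 := le_symmInvSq (g := g) (x := a) (c := 26.6 - a₀) (d := 26.6 + a₁) (by linarith)
      (by linarith) (by linarith) (by rw [abs_le]; constructor <;> linarith) (by linarith)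
    have e2 := le_symmInvSq (g := g) (x := b) (c := 26.6 - b₀) (d := 26.6 + b₁) (by linarith)
      (by linarith) (by linarith) (by rw [abs_le]; constructor <;> linarith) (by linarith)
    have e3 : 1 / a ^ 2 ≤ 1 / a₀ ^ 2 := by gcongr
    have e4 : 1 / b ^ 2 ≤ 1 / b₀ ^ 2 := by gcongr
    have e5 : 1 / (a₁ + b₁) ^ 2 ≤ 1 / (a + b) ^ 2 := by gcongr
    rw [reflInvSq] at hS
    linarith
  rcases le_total 14.2 a with h | h
  · have := bound 14.2 15.05 19.6 21.55 (by norm_num) h ha2.le (by norm_num) hb1.le hb2.le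
    norm_num at this ⊢
    linarith
  rcases le_total 20 b with h' | h'
  · have := bound 13.86 14.2 20 21.55 (by norm_num) ha1.le h (by norm_num) h' hb2.le
    norm_num at this ⊢
    linarith
  · have := bound 13.86 14.2 19.6 20 (by norm_num) ha1.le h (by norm_num) hb1.le h'
    norm_num at this ⊢
    linarith

lemma lt_of_first_and_third_zero {a b g S : ℝ} (ha : a ∈ Set.Ioo (13.86 : ℝ) 15.05)
    (hb : b ∈ Set.Ioo (21.45 : ℝ) 26.6) (hg : g ∈ Set.Ioo (19.6 : ℝ) 21.55) (hgb : g < b)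
    (hS : symmInvSq g a + symmInvSq g b + reflInvSq a b ≤ S) :
    4 * (1 / a ^ 2 + 1 / b ^ 2) < S := by
  obtain ⟨ha1, ha2⟩ := ha
  obtain ⟨hb1, hb2⟩ := hb
  obtain ⟨hg1, hg2⟩ := hg
  have e1 := le_symmInvSq (g := g) (x := a) (c := 7.69) (d := 36.6) (by linarith) (by linarith)
    (by linarith) (by rw [abs_le]; constructor <;> linarith) (by linarith)
  have e2 := le_symmInvSq (g := g) (x := b) (c := 7) (d := 48.15) (by linarith) (by linarith)
    (by linarith) (by rw [abs_le]; constructor <;> linarith) (by linarith)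
  have e3 : 1 / a ^ 2 ≤ 1 / 13.86 ^ 2 := by gcongr
  have e4 : 1 / b ^ 2 ≤ 1 / 21.45 ^ 2 := by gcongr
  have e5 : 0 < 1 / (a + b) ^ 2 := by
    have : 0 < a + b := by linarith
    positivity
  rw [reflInvSq] at hS
  generalize 1 / a ^ 2 = A at e3 hS ⊢
  generalize 1 / b ^ 2 = B at e4 hS ⊢
  generalize 1 / (a + b) ^ 2 = C at e5 hS
  norm_num at e1 e2 e3 e4
  linarith

lemma lt_of_first_zero {a b g h S : ℝ} (ha : a ∈ Set.Ioo (13.86 : ℝ) 15.05) (hb : 12.25 < b)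
    (hg : g ∈ Set.Ioo (19.6 : ℝ) 21.55) (hh : h ∈ Set.Ioo (21.45 : ℝ) 26.6) (hgb : g ≠ b)
    (hhb : h ≠ b)
    (hS : symmInvSq g a + symmInvSq g b + (symmInvSq h a + symmInvSq h b) + reflInvSq a b ≤ S) :
    4 * (1 / a ^ 2 + 1 / b ^ 2) < S := by
  obtain ⟨ha1, ha2⟩ := ha
  obtain ⟨hg1, hg2⟩ := hg
  obtain ⟨hh1, hh2⟩ := hh
  have hb0 : 0 < b := by linarith
  have e1 := le_symmInvSq (g := g) (x := a) (c := 7.69) (d := 36.6) (by linarith) (by linarith)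
    (by linarith) (by rw [abs_le]; constructor <;> linarith) (by linarith)
  have e2 := le_symmInvSq (g := h) (x := a) (c := 12.74) (d := 41.65) (by linarith) (by linarith)
    (by linarith) (by rw [abs_le]; constructor <;> linarith) (by linarith)
  have e3 : 1 / a ^ 2 ≤ 1 / 13.86 ^ 2 := by gcongr
  have e4 : 0 < 1 / b ^ 2 := by positivity
  have e5 : 0 < 1 / (a + b) ^ 2 := by positivity
  rw [reflInvSq] at hS
  have side : 4 * (1 / b ^ 2) ≤ symmInvSq g b + symmInvSq h b →
      4 * (1 / a ^ 2 + 1 / b ^ 2) < S := by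
    intro hside
    generalize 1 / a ^ 2 = A at e3 hS ⊢
    generalize 1 / b ^ 2 = B at e4 hS hside ⊢
    norm_num at e1 e2 e3
    linarith
  have hgn := symmInvSq_nonneg g b
  have hhn := symmInvSq_nonneg h b
  rcases le_total 41 b with h41 | h41
  · have f1 := two_le_symmInvSq (g := g) hb0 (by linarith) (by linarith) hgb
    have f2 := two_le_symmInvSq (g := h) hb0 (by linarith) (by linarith) hhb
    exact side (by linarith)
  rcases le_total 14.3 b with h14 | h14
  · have f1 := four_le_symmInvSq (g := g) hb0 (by linarith) (by linarith) hgb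
    exact side (by linarith)
  have bound : ∀ b₀ b₁ : ℝ, 12 ≤ b₀ → b₀ ≤ b → b ≤ b₁ →
      1 / (21.55 - b₀) ^ 2 + 1 / (21.55 + b₁) ^ 2 + (1 / (26.6 - b₀) ^ 2 + 1 / (26.6 + b₁) ^ 2)
        + 2 * (1 / (15.05 + b₁) ^ 2) - 15 / 4 * (1 / b₀ ^ 2)
        ≤ symmInvSq g b + symmInvSq h b + 2 * (1 / (a + b) ^ 2) - 15 / 4 * (1 / b ^ 2) := by
    intro b₀ b₁ h1 h2 h3
    have e1 := le_symmInvSq (g := g) (x := b) (c := 21.55 - b₀) (d := 21.55 + b₁) (by linarith)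
      (by linarith) (by linarith) (by rw [abs_le]; constructor <;> linarith) (by linarith)
    have e2 := le_symmInvSq (g := h) (x := b) (c := 26.6 - b₀) (d := 26.6 + b₁) (by linarith)
      (by linarith) (by linarith) (by rw [abs_le]; constructor <;> linarith) (by linarith)
    have e4 : 1 / b ^ 2 ≤ 1 / b₀ ^ 2 := by gcongr
    have e5 : 1 / (15.05 + b₁) ^ 2 ≤ 1 / (a + b) ^ 2 := by gcongr
    linarith
  rcases le_total 12.6 b with h12 | h12
  · have := bound 12.6 14.3 (by norm_num) h12 h14
    norm_num at this e1 e2 e3 hS ⊢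
    linarith
  · have := bound 12.25 12.6 (by norm_num) hb.le h12
    norm_num at this e1 e2 e3 hS ⊢
    linarith

lemma four_le_symmInvSq_first {g x : ℝ} (hg : g ∈ Set.Ioo (13.86 : ℝ) 15.05) (hx : 12.25 < x)
    (hx' : x ≤ 29.5) (hne : g ≠ x) : 4 * (1 / x ^ 2) ≤ symmInvSq g x :=
  four_le_symmInvSq (by linarith) (by linarith [hg.1]) (by linarith [hg.2]) hne

lemma four_le_symmInvSq_add {g h x : ℝ} (hg : g ∈ Set.Ioo (13.86 : ℝ) 15.05)
    (hh : h ∈ Set.Ioo (19.6 : ℝ) 26.6) (hx : 12.25 < x) (hgx : g ≠ x) (hhx : h ≠ x) :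
    4 * (1 / x ^ 2) ≤ symmInvSq g x + symmInvSq h x := by
  obtain ⟨hg1, hg2⟩ := hg
  obtain ⟨hh1, hh2⟩ := hh
  rcases le_total x 29.5 with h29 | h29
  · have := four_le_symmInvSq_first ⟨hg1, hg2⟩ hx h29 hgx
    linarith [symmInvSq_nonneg h x]
  · have f1 := two_le_symmInvSq (g := g) (x := x) (by linarith) (by linarith) (by linarith) hgx
    have f2 := two_le_symmInvSq (g := h) (x := x) (by linarith) (by linarith) (by linarith) hhx
    linarith

lemma reflInvSq_pos {a b : ℝ} (ha : 0 < a) (hb : 0 < b) : 0 < reflInvSq a b := by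
  unfold reflInvSq
  positivity

lemma reflInvSq_comm (a b : ℝ) : reflInvSq a b = reflInvSq b a := by
  unfold reflInvSq
  ring

lemma IsSimpleZeroZ.four_mul_lt_tsum {a b : ℝ} (hsa : IsSimpleZeroZ a) (hsb : IsSimpleZeroZ b)
    (ha : 12.25 < a) (hb : 12.25 < b) (hab : a ≠ b) :
    4 * (1 / a ^ 2 + 1 / b ^ 2) <
      ∑' t : {t : ℝ // HardyZ t = 0 ∧ t ≠ a ∧ t ≠ b},
        (1 / ((t : ℝ) - a) ^ 2 + 1 / ((t : ℝ) - b) ^ 2) := by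
  obtain ⟨g₁, g₂, g₃, z₁, z₂, z₃, h₁, h₂, h₃, h₂₃⟩ := exists_first_three_zeros
  have ha0 : 0 < a := by linarith
  have hb0 : 0 < b := by linarith
  have one := fun {g : ℝ} => hsa.symmInvSq_add_le_tsum hsb ha0 hb0 hab (g := g)
  have two := fun {g h : ℝ} => hsa.symmInvSq_add_add_le_tsum hsb ha0 hb0 hab (g := g) (h := h)
  have hE := reflInvSq_pos ha0 hb0
  have p₁ : 0 < g₁ := by linarith [h₁.1]
  have p₂ : 0 < g₂ := by linarith [h₂.1]
  have p₃ : 0 < g₃ := by linarith [h₃.1]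
  have h₁₂ : g₁ < g₂ := by linarith [h₁.2, h₂.1]
  generalize (∑' t : {t : ℝ // HardyZ t = 0 ∧ t ≠ a ∧ t ≠ b},
        (1 / ((t : ℝ) - a) ^ 2 + 1 / ((t : ℝ) - b) ^ 2)) = S at one two ⊢
  by_cases c₁ : g₁ = a
  · subst c₁
    by_cases c₂ : g₂ = b
    · subst c₂
      exact lt_of_first_and_second_zero h₁ h₂ h₃ h₂₃
        (one z₃ p₃ (h₁₂.trans h₂₃).ne' h₂₃.ne')
    by_cases c₃ : g₃ = b
    · subst c₃
      exact lt_of_first_and_third_zero h₁ h₃ h₂ h₂₃ (one z₂ p₂ h₁₂.ne' h₂₃.ne)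
    exact lt_of_first_zero h₁ hb h₂ h₃ c₂ c₃
      (two z₂ p₂ h₁₂.ne' c₂ z₃ p₃ (h₁₂.trans h₂₃).ne' c₃ h₂₃.ne)
  by_cases d₁ : g₁ = b
  · subst d₁
    rw [add_comm (1 / a ^ 2)]
    by_cases c₂ : g₂ = a
    · subst c₂
      have := one z₃ p₃ h₂₃.ne' (h₁₂.trans h₂₃).ne'
      rw [reflInvSq_comm] at this
      exact lt_of_first_and_second_zero h₁ h₂ h₃ h₂₃ (by linarith)
    by_cases c₃ : g₃ = a
    · subst c₃
      have := one z₂ p₂ h₂₃.ne h₁₂.ne'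
      rw [reflInvSq_comm] at this
      exact lt_of_first_and_third_zero h₁ h₃ h₂ h₂₃ (by linarith)
    have := two z₂ p₂ c₂ h₁₂.ne' z₃ p₃ c₃ (h₁₂.trans h₂₃).ne' h₂₃.ne
    rw [reflInvSq_comm] at this
    exact lt_of_first_zero h₁ ha h₂ h₃ c₂ c₃ (by linarith)
  by_cases c₂ : g₂ ≠ a ∧ g₂ ≠ b
  · have := two z₁ p₁ c₁ d₁ z₂ p₂ c₂.1 c₂.2 h₁₂.ne
    have m₂ : g₂ ∈ Set.Ioo (19.6 : ℝ) 26.6 := ⟨h₂.1, by linarith [h₂.2]⟩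
    linarith [four_le_symmInvSq_add h₁ m₂ ha c₁ c₂.1, four_le_symmInvSq_add h₁ m₂ hb d₁ c₂.2]
  by_cases c₃ : g₃ ≠ a ∧ g₃ ≠ b
  · have := two z₁ p₁ c₁ d₁ z₃ p₃ c₃.1 c₃.2 (h₁₂.trans h₂₃).ne
    have m₃ : g₃ ∈ Set.Ioo (19.6 : ℝ) 26.6 := ⟨by linarith [h₃.1], h₃.2⟩
    linarith [four_le_symmInvSq_add h₁ m₃ ha c₁ c₃.1, four_le_symmInvSq_add h₁ m₃ hb d₁ c₃.2]
  have hle : a ≤ 29.5 ∧ b ≤ 29.5 := by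
    have := h₂.2
    have := h₃.2
    grind
  linarith [one z₁ p₁ c₁ d₁, four_le_symmInvSq_first h₁ ha hle.1 c₁,
    four_le_symmInvSq_first h₁ hb hle.2 d₁]

/-- Under RH, for every pair of distinct simple zeros `γ₁, γ₂ ≥ γ₁'` of Hardy's
Z-function, `ḡ_{γ₁,γ₂} > 4(γ₁−γ₂)²(1/γ₁² + 1/γ₂²)`. -/
theorem gbar_lower_bound (hRH : RiemannHypothesis) (γ₁ γ₂ : ℝ)
    (h₁ : firstZeroOrdinate ≤ γ₁) (h₂ : firstZeroOrdinate ≤ γ₂) (hne : γ₁ ≠ γ₂)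
    (hs₁ : IsSimpleZeroZ γ₁) (hs₂ : IsSimpleZeroZ γ₂) :
    gbar γ₁ γ₂ > 4 * (γ₁ - γ₂) ^ 2 * (1 / γ₁ ^ 2 + 1 / γ₂ ^ 2) := by
  have lower : ∀ γ, firstZeroOrdinate ≤ γ → IsSimpleZeroZ γ → 12.25 < γ := fun γ h hs =>
    lt_of_xiLine_eq_zero (firstZeroOrdinate_nonneg.trans h) ((HardyZ_eq_zero_iff γ).mp hs.1)
  have hsq : 0 < (γ₁ - γ₂) ^ 2 := by
    have := sub_ne_zero.mpr hne
    positivity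
  rw [gbar, gt_iff_lt, mul_comm 4, mul_assoc]
  exact mul_lt_mul_of_pos_left
    (hs₁.four_mul_lt_tsum hs₂ (lower γ₁ h₁ hs₁) (lower γ₂ h₂ hs₂) hne) hsq
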